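/- Let λ < λ_c be fixed and suppose the edge-probability satisfies p(n) ≤ λ n^{-1/2}. Then there is a constant C = C(λ) > 0 such that for Γ ∈ G(n,p), asymptotically almost surely every connected component of ⊠(Γ) has support of size at most C·(log n)^{2^{31}}. -/

import Mathlib

open MeasureTheory Filter

noncomputable section

/-- The critical constant `λ_c = √(√6 - 2)`. -/
def lambdaC : ℝ := Real.sqrt (Real.sqrt 6 - 2)

/-- The Bernoulli measure on `Bool` with success probability `p`. -/
def bernoulliBool (p : ℝ) : Measure Bool :=
  ENNReal.ofReal p • Measure.dirac true + ENNReal.ofReal (1 - p) • Measure.dirac false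

/-- The Erdős–Rényi measure: each potential edge of a graph on `Fin n` is present
independently with probability `p`. -/
def erMeasure (n : ℕ) (p : ℝ) : Measure (Sym2 (Fin n) → Bool) :=
  Measure.pi fun _ => bernoulliBool p

/-- The graph determined by a Boolean function on unordered pairs. -/
def graphOf {n : ℕ} (ω : Sym2 (Fin n) → Bool) : SimpleGraph (Fin n) :=
  SimpleGraph.fromRel fun x y => ω s(x, y) = true

/-- `e` is a non-edge of `Γ`: a pair of distinct non-adjacent vertices. -/
def IsNonEdge {V : Type*} (Γ : SimpleGraph V) (e : Sym2 V) : Prop :=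
  ¬ e.IsDiag ∧ e ∉ Γ.edgeSet

/-- Two pairs are related if they are the diagonals of an induced 4-cycle of `Γ`. -/
def squareAdj {V : Type*} (Γ : SimpleGraph V) (e f : Sym2 V) : Prop :=
  ∃ a b c d : V, e = s(a, c) ∧ f = s(b, d) ∧ a ≠ c ∧ b ≠ d ∧
    ¬ Γ.Adj a c ∧ ¬ Γ.Adj b d ∧ Γ.Adj a b ∧ Γ.Adj b c ∧ Γ.Adj c d ∧ Γ.Adj d a

/-- The square-graph `□(Γ)`: vertices are pairs (its relevant vertices being non-edges of
`Γ`), and edges join the two diagonals of each induced 4-cycle of `Γ`. -/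
def squareGraph {V : Type*} (Γ : SimpleGraph V) : SimpleGraph (Sym2 V) :=
  SimpleGraph.fromRel (squareAdj Γ)

/-- The square-component of a pair `e`: its connected component in `□(Γ)`. -/
def squareComponent {V : Type*} (Γ : SimpleGraph V) (e : Sym2 V) : Set (Sym2 V) :=
  {f | (squareGraph Γ).Reachable e f}

/-- The support of a collection of pairs: the union of the pairs. -/
def suppOf {V : Type*} (C : Set (Sym2 V)) : Set V :=
  {v | ∃ e ∈ C, v ∈ e}
/-- Two pairs are related if they are the diagonals of a (not necessarily induced)
4-cycle of `Γ`. -/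
def boxAdj {V : Type*} (Γ : SimpleGraph V) (e f : Sym2 V) : Prop :=
  ∃ a b c d : V, e = s(a, c) ∧ f = s(b, d) ∧ a ≠ c ∧ b ≠ d ∧
    Γ.Adj a b ∧ Γ.Adj b c ∧ Γ.Adj c d ∧ Γ.Adj d a

/-- The graph `⊠(Γ)`: vertices are the unordered pairs of distinct vertices of `Γ`,
and edges join the two diagonals of each (not necessarily induced) 4-cycle of `Γ`. -/
def boxGraph {V : Type*} (Γ : SimpleGraph V) : SimpleGraph (Sym2 V) :=
  SimpleGraph.fromRel (boxAdj Γ)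

/-- The connected component of a pair `e` in `⊠(Γ)`. -/
def boxComponent {V : Type*} (Γ : SimpleGraph V) (e : Sym2 V) : Set (Sym2 V) :=
  {f | (boxGraph Γ).Reachable e f}

/-! ### The product weight on configurations -/

section Weight

variable {E : Type*} [Fintype E]

/-- The Bernoulli weight of a single bit. -/
def bitWeight (p : ℝ) (b : Bool) : ℝ := if b then p else 1 - p

/-- The product Bernoulli weight of a configuration. -/
def configWeight (p : ℝ) (ω : E → Bool) : ℝ := ∏ e, bitWeight p (ω e)

lemma bitWeight_nonneg {p : ℝ} (h0 : 0 ≤ p) (h1 : p ≤ 1) (b : Bool) : 0 ≤ bitWeight p b := by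
  cases b <;> simp [bitWeight, h0, h1]

lemma configWeight_nonneg {p : ℝ} (h0 : 0 ≤ p) (h1 : p ≤ 1) (ω : E → Bool) :
    0 ≤ configWeight p ω :=
  Finset.prod_nonneg fun _ _ => bitWeight_nonneg h0 h1 _

variable [DecidableEq E]

lemma sum_prod_bits (h : E → Bool → ℝ) :
    ∑ ω : E → Bool, ∏ e, h e (ω e) = ∏ e, ∑ b, h e b := by
  rw [Finset.prod_univ_sum, Fintype.piFinset_univ]

lemma sum_configWeight (p : ℝ) : ∑ ω : E → Bool, configWeight p ω = 1 := by
  simp only [configWeight]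
  rw [sum_prod_bits (fun _ => bitWeight p)]
  simp [bitWeight]

/-- Requiring the bits in `T` to be `true` multiplies the weight of a cylinder over a
disjoint set of coordinates by `p ^ T.card`. -/
lemma sum_cylinder_inter (p : ℝ) (F : E → Prop) [DecidablePred F] (ω₀ : E → Bool)
    (T : Finset E) (hT : ∀ e ∈ T, ¬ F e) :
    ∑ ω : E → Bool with (∀ e, F e → ω e = ω₀ e) ∧ ∀ e ∈ T, ω e = true, configWeight p ω
      = p ^ T.card * ∑ ω : E → Bool with ∀ e, F e → ω e = ω₀ e, configWeight p ω := by
  have key : ∀ T : Finset E,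
      ∑ ω : E → Bool with (∀ e, F e → ω e = ω₀ e) ∧ ∀ e ∈ T, ω e = true, configWeight p ω
      = ∏ e, ∑ b : Bool, (if (F e → b = ω₀ e) ∧ (e ∈ T → b = true) then bitWeight p b else 0) := by
    intro T
    rw [← sum_prod_bits (E := E)
      (fun e b => if (F e → b = ω₀ e) ∧ (e ∈ T → b = true) then bitWeight p b else 0),
      Finset.sum_filter]
    refine Finset.sum_congr rfl fun ω _ => ?_
    rw [Finset.prod_ite_zero]
    simp only [Finset.mem_univ, true_imp_iff, forall_and, configWeight]
  have h0 := key ∅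
  simp only [Finset.notMem_empty, false_imp_iff, implies_true, and_true] at h0
  have h1 : p ^ T.card = ∏ e, if e ∈ T then p else 1 := by
    simp [Finset.prod_ite_mem]
  rw [key T, h0, h1, ← Finset.prod_mul_distrib]
  refine Finset.prod_congr rfl fun e _ => ?_
  by_cases he : e ∈ T
  · simp [he, hT e he, bitWeight]
  · simp [he]

end Weight

/-! ### Configurations on the edges of a complete graph -/

section Adjacency

variable {V : Type*}

/-- Two configurations agree on all edges meeting `X`. -/
def AgreeOn (X : Finset V) (ω ω' : Sym2 V → Bool) : Prop :=
  ∀ e : Sym2 V, (∃ x ∈ X, x ∈ e) → ω e = ω' e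

lemma AgreeOn.symm {X : Finset V} {ω ω' : Sym2 V → Bool} (h : AgreeOn X ω ω') :
    AgreeOn X ω' ω := fun e he => (h e he).symm

lemma AgreeOn.trans {X : Finset V} {ω ω' ω'' : Sym2 V → Bool} (h : AgreeOn X ω ω')
    (h' : AgreeOn X ω' ω'') : AgreeOn X ω ω'' := fun e he => (h e he).trans (h' e he)

lemma AgreeOn.mono {X Y : Finset V} (hXY : X ⊆ Y) {ω ω' : Sym2 V → Bool} (h : AgreeOn Y ω ω') :
    AgreeOn X ω ω' := fun e ⟨x, hx, hxe⟩ => h e ⟨x, hXY hx, hxe⟩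

/-- Adjacency in the graph of a configuration. -/
def EdgeOn (ω : Sym2 V → Bool) (x y : V) : Prop := x ≠ y ∧ ω s(x, y) = true

lemma EdgeOn.symm {ω : Sym2 V → Bool} {x y : V} (h : EdgeOn ω x y) : EdgeOn ω y x :=
  ⟨h.1.symm, by rw [Sym2.eq_swap]; exact h.2⟩

lemma edgeOn_comm {ω : Sym2 V → Bool} {x y : V} : EdgeOn ω x y ↔ EdgeOn ω y x :=
  ⟨EdgeOn.symm, EdgeOn.symm⟩

lemma graphOf_adj {n : ℕ} {ω : Sym2 (Fin n) → Bool} {x y : Fin n} :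
    (graphOf ω).Adj x y ↔ EdgeOn ω x y := by
  simp only [graphOf, SimpleGraph.fromRel_adj, EdgeOn, Sym2.eq_swap (a := y) (b := x), or_self]

lemma AgreeOn.edgeOn_left {X : Finset V} {ω ω' : Sym2 V → Bool} (h : AgreeOn X ω ω') {x y : V}
    (hx : x ∈ X) : EdgeOn ω x y ↔ EdgeOn ω' x y := by
  rw [EdgeOn, EdgeOn, h s(x, y) ⟨x, hx, Sym2.mem_mk_left _ _⟩]

lemma AgreeOn.edgeOn_right {X : Finset V} {ω ω' : Sym2 V → Bool} (h : AgreeOn X ω ω') {x y : V}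
    (hy : y ∈ X) : EdgeOn ω x y ↔ EdgeOn ω' x y := by
  rw [edgeOn_comm, h.edgeOn_left hy, edgeOn_comm]

variable [DecidableEq V]

instance (ω : Sym2 V → Bool) (x y : V) : Decidable (EdgeOn ω x y) :=
  inferInstanceAs (Decidable (_ ∧ _))

variable [Fintype V]

instance (X : Finset V) (ω ω₀ : Sym2 V → Bool) : Decidable (AgreeOn X ω ω₀) :=
  inferInstanceAs (Decidable (∀ e : Sym2 V, (∃ x ∈ X, x ∈ e) → ω e = ω₀ e))

/-- The configurations agreeing with `ω₀` on all edges meeting `X`. -/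
def edgeCylinder (X : Finset V) (ω₀ : Sym2 V → Bool) : Finset (Sym2 V → Bool) :=
  Finset.univ.filter fun ω => AgreeOn X ω ω₀

lemma mem_edgeCylinder {X : Finset V} {ω₀ ω : Sym2 V → Bool} :
    ω ∈ edgeCylinder X ω₀ ↔ AgreeOn X ω ω₀ := by simp [edgeCylinder]

lemma edgeCylinder_eq_of_agreeOn {X : Finset V} {ω₀ ω₁ : Sym2 V → Bool} (h : AgreeOn X ω₁ ω₀) :
    edgeCylinder X ω₁ = edgeCylinder X ω₀ := by
  ext ω
  simp only [mem_edgeCylinder]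
  exact ⟨fun h' => h'.trans h, fun h' => h'.trans h.symm⟩

lemma edgeCylinder_empty (ω₀ : Sym2 V → Bool) : edgeCylinder ∅ ω₀ = Finset.univ := by
  ext ω
  simp [mem_edgeCylinder, AgreeOn]

/-- The total weight of a cylinder. -/
def cylinderMass (p : ℝ) (X : Finset V) (ω₀ : Sym2 V → Bool) : ℝ :=
  ∑ ω ∈ edgeCylinder X ω₀, configWeight p ω

lemma cylinderMass_nonneg {p : ℝ} (h0 : 0 ≤ p) (h1 : p ≤ 1) (X : Finset V) (ω₀ : Sym2 V → Bool) :
    0 ≤ cylinderMass p X ω₀ :=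
  Finset.sum_nonneg fun _ _ => configWeight_nonneg h0 h1 _

/-- The part of the mass of a cylinder carried by the event `B`. -/
def eventMass (p : ℝ) (B : (Sym2 V → Bool) → Prop) [DecidablePred B] (X : Finset V)
    (ω₀ : Sym2 V → Bool) : ℝ :=
  ∑ ω ∈ edgeCylinder X ω₀ with B ω, configWeight p ω

lemma eventMass_le_cylinderMass {p : ℝ} (h0 : 0 ≤ p) (h1 : p ≤ 1) (B : (Sym2 V → Bool) → Prop)
    [DecidablePred B] (X : Finset V) (ω₀ : Sym2 V → Bool) :
    eventMass p B X ω₀ ≤ cylinderMass p X ω₀ :=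
  Finset.sum_le_sum_of_subset_of_nonneg (Finset.filter_subset _ _)
    fun _ _ _ => configWeight_nonneg h0 h1 _

/-- Averaging over the edges exposed when passing from `X` to a larger set `Y`. -/
lemma eventMass_le_sum {p : ℝ} (h0 : 0 ≤ p) (h1 : p ≤ 1) (B : (Sym2 V → Bool) → Prop)
    [DecidablePred B] {X Y : Finset V} (hXY : X ⊆ Y) (ω₀ : Sym2 V → Bool)
    (g : (Sym2 V → Bool) → ℝ) (hg : ∀ ω, 0 ≤ g ω)
    (hgY : ∀ ω ω', AgreeOn Y ω ω' → g ω = g ω')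
    (h : ∀ ω₁, AgreeOn X ω₁ ω₀ → B ω₁ → eventMass p B Y ω₁ ≤ cylinderMass p Y ω₁ * g ω₁) :
    eventMass p B X ω₀ ≤ ∑ ω ∈ edgeCylinder X ω₀, configWeight p ω * g ω := by
  classical
  let ρ : (Sym2 V → Bool) → (Sym2 V → Bool) :=
    fun ω e => if ∃ x ∈ Y, x ∈ e then ω e else false
  have hρ : ∀ ω ω', ρ ω = ρ ω' ↔ AgreeOn Y ω ω' := by
    intro ω ω'
    constructor
    · intro h e he
      have := congrFun h e
      simpa only [ρ, if_pos he] using this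
    · intro h
      funext e
      by_cases he : ∃ x ∈ Y, x ∈ e
      · simp only [ρ, if_pos he, h e he]
      · simp only [ρ, if_neg he]
  have hfib : ∀ ω₁, AgreeOn X ω₁ ω₀ → (edgeCylinder X ω₀).filter (fun ω => ρ ω = ρ ω₁)
      = edgeCylinder Y ω₁ := by
    intro ω₁ h₁
    ext ω
    simp only [Finset.mem_filter, mem_edgeCylinder, hρ]
    exact ⟨fun h => h.2, fun h => ⟨(h.mono hXY).trans h₁, h⟩⟩
  have e1 : eventMass p B X ω₀
      = ∑ ω ∈ edgeCylinder X ω₀, if B ω then configWeight p ω else 0 := by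
    rw [eventMass, Finset.sum_filter]
  rw [e1, ← Finset.sum_fiberwise_of_maps_to
      (t := (edgeCylinder X ω₀).image ρ) (g := ρ) (fun ω hω => Finset.mem_image_of_mem _ hω),
    ← Finset.sum_fiberwise_of_maps_to (s := edgeCylinder X ω₀)
      (t := (edgeCylinder X ω₀).image ρ) (g := ρ) (fun ω hω => Finset.mem_image_of_mem _ hω)]
  refine Finset.sum_le_sum fun c hc => ?_
  obtain ⟨ω₂, hω₂, rfl⟩ := Finset.mem_image.1 hc
  rw [mem_edgeCylinder] at hω₂
  rw [hfib ω₂ hω₂]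
  by_cases hB : ∃ ω₁ ∈ edgeCylinder Y ω₂, B ω₁
  · obtain ⟨ω₁, hω₁, hBω₁⟩ := hB
    rw [mem_edgeCylinder] at hω₁
    rw [← edgeCylinder_eq_of_agreeOn hω₁, ← Finset.sum_filter]
    refine (h ω₁ ((hω₁.mono hXY).trans hω₂) hBω₁).trans (le_of_eq ?_)
    rw [cylinderMass, Finset.sum_mul]
    refine Finset.sum_congr rfl fun ω hω => ?_
    rw [hgY ω ω₁ (mem_edgeCylinder.1 hω)]
  · push Not at hB
    rw [Finset.sum_congr rfl fun ω hω => if_neg (hB ω hω), Finset.sum_const_zero]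
    exact Finset.sum_nonneg fun ω _ => mul_nonneg (configWeight_nonneg h0 h1 _) (hg ω)

/-- The mass of the part of a cylinder on which all edges of `T`, none of which meets `X`, are
present. -/
lemma sum_edgeCylinder_inter (p : ℝ) (X : Finset V) (ω₀ : Sym2 V → Bool) (T : Finset (Sym2 V))
    (hT : ∀ e ∈ T, ∀ x ∈ X, x ∉ e) :
    ∑ ω ∈ edgeCylinder X ω₀ with ∀ e ∈ T, ω e = true, configWeight p ω
      = p ^ T.card * cylinderMass p X ω₀ := by
  have := sum_cylinder_inter p (fun e : Sym2 V => ∃ x ∈ X, x ∈ e) ω₀ T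
    (fun e he ⟨x, hx, hxe⟩ => hT e he x hx hxe)
  have h1 : edgeCylinder X ω₀
      = Finset.univ.filter fun ω => ∀ e : Sym2 V, (∃ x ∈ X, x ∈ e) → ω e = ω₀ e := by
    ext ω
    simp [mem_edgeCylinder, AgreeOn]
  rw [cylinderMass, h1, Finset.filter_filter, this]

lemma sum_edgeCylinder_edgeOn (p : ℝ) (X : Finset V) (ω₀ : Sym2 V → Bool) {z w : V} (hz : z ∉ X)
    (hw : w ∉ X) (hzw : z ≠ w) :
    ∑ ω ∈ edgeCylinder X ω₀, configWeight p ω * (if EdgeOn ω z w then 1 else 0)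
      = p * cylinderMass p X ω₀ := by
  have := sum_edgeCylinder_inter p X ω₀ {s(z, w)} (by
    simp only [Finset.mem_singleton, forall_eq, Sym2.mem_iff, not_or]
    exact fun x hx => ⟨fun h => hz (h ▸ hx), fun h => hw (h ▸ hx)⟩)
  simp only [Finset.card_singleton, pow_one] at this
  rw [← this]
  simp only [mul_ite, mul_one, mul_zero]
  rw [← Finset.sum_filter]
  simp [EdgeOn, hzw]

lemma sum_edgeCylinder_edgeOn_edgeOn (p : ℝ) (X : Finset V) (ω₀ : Sym2 V → Bool) {z w w' : V}
    (hz : z ∉ X) (hw : w ∉ X) (hw' : w' ∉ X) (hzw : z ≠ w) (hzw' : z ≠ w') (hww' : w ≠ w') :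
    ∑ ω ∈ edgeCylinder X ω₀, configWeight p ω * (if EdgeOn ω z w ∧ EdgeOn ω z w' then 1 else 0)
      = p ^ 2 * cylinderMass p X ω₀ := by
  have := sum_edgeCylinder_inter p X ω₀ {s(z, w), s(z, w')} (by
    simp only [Finset.mem_insert, Finset.mem_singleton, forall_eq_or_imp, forall_eq, Sym2.mem_iff,
      not_or]
    exact ⟨fun x hx => ⟨fun h => hz (h ▸ hx), fun h => hw (h ▸ hx)⟩,
      fun x hx => ⟨fun h => hz (h ▸ hx), fun h => hw' (h ▸ hx)⟩⟩)
  rw [Finset.card_pair (by simp [hww', hzw'])] at this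
  rw [← this]
  simp only [mul_ite, mul_one, mul_zero]
  rw [← Finset.sum_filter]
  simp [EdgeOn, hzw, hzw']

end Adjacency

/-! ### Exploration states -/

section Exploration

variable {V : Type*}

/-- A state of the exploration: all edges meeting the exposed set `X` are known, `S` is the set of
discovered vertices, `A` the set of (ordered) active pairs, which is closed under known 4-cycles,
and each unexposed discovered vertex is in at most `r` active pairs. -/
structure Exploration (ω : Sym2 V → Bool) (X S : Finset V) (A : Finset (V × V)) (r : ℕ) : Prop where
  exposed_subset : X ⊆ S
  fst_mem : ∀ {s t}, (s, t) ∈ A → s ∈ S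
  ne : ∀ {s t}, (s, t) ∈ A → s ≠ t
  symm : ∀ {s t}, (s, t) ∈ A → (t, s) ∈ A
  closed : ∀ {u v s t}, (u, v) ∈ A → s ≠ t → EdgeOn ω u s → EdgeOn ω v s → EdgeOn ω u t →
    EdgeOn ω v t → (u ∈ X ∧ v ∈ X ∨ s ∈ X ∧ t ∈ X) → (s, t) ∈ A
  card_le : ∀ z ∈ S, z ∉ X → ∀ T : Finset V, (∀ a ∈ T, (z, a) ∈ A) → T.card ≤ r

namespace Exploration

variable {ω ω' : Sym2 V → Bool} {X S : Finset V} {A : Finset (V × V)} {r : ℕ}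

lemma snd_mem (h : Exploration ω X S A r) {s t : V} (hst : (s, t) ∈ A) : t ∈ S :=
  h.fst_mem (h.symm hst)

lemma congr (h : Exploration ω X S A r) (hω : AgreeOn X ω ω') : Exploration ω' X S A r where
  exposed_subset := h.exposed_subset
  fst_mem := h.fst_mem
  ne := h.ne
  symm := h.symm
  card_le := h.card_le
  closed := by
    intro u v s t huv hst hus hvs hut hvt hX
    refine h.closed huv hst ?_ ?_ ?_ ?_ hX <;> rcases hX with ⟨h1, h2⟩ | ⟨h1, h2⟩ <;>
      first
        | simpa only [hω.edgeOn_left h1] | simpa only [hω.edgeOn_right h1]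
        | simpa only [hω.edgeOn_left h2] | simpa only [hω.edgeOn_right h2]

end Exploration

variable [DecidableEq V]

/-- The common neighbours of `s` and `t` inside `Y`. -/
def commonNbrs (ω : Sym2 V → Bool) (Y : Finset V) (s t : V) : Finset V :=
  Y.filter fun x => EdgeOn ω s x ∧ EdgeOn ω t x

/-- The neighbours of `v` inside `Y`. -/
def nbrsIn (ω : Sym2 V → Bool) (Y : Finset V) (v : V) : Finset V :=
  Y.filter fun x => EdgeOn ω v x

lemma mem_commonNbrs {ω : Sym2 V → Bool} {Y : Finset V} {s t x : V} :
    x ∈ commonNbrs ω Y s t ↔ x ∈ Y ∧ EdgeOn ω s x ∧ EdgeOn ω t x := by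
  simp [commonNbrs]

lemma mem_nbrsIn {ω : Sym2 V → Bool} {Y : Finset V} {v x : V} :
    x ∈ nbrsIn ω Y v ↔ x ∈ Y ∧ EdgeOn ω v x := by
  simp [nbrsIn]

lemma commonNbrs_comm (ω : Sym2 V → Bool) (Y : Finset V) (s t : V) :
    commonNbrs ω Y s t = commonNbrs ω Y t s := by
  ext x
  simp only [mem_commonNbrs]
  tauto

lemma commonNbrs_mono (ω : Sym2 V → Bool) {Y Z : Finset V} (h : Y ⊆ Z) (s t : V) :
    commonNbrs ω Y s t ⊆ commonNbrs ω Z s t :=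
  Finset.filter_subset_filter _ h

/-- The weight of an ordered pair in an exploration with exposed set `X`: the number of its known
common neighbours, but at least two. -/
def pairWeight (ω : Sym2 V → Bool) (X : Finset V) (q : V × V) : ℕ :=
  max 2 (commonNbrs ω X q.1 q.2).card

/-- The active pairs with an endpoint that is not exposed. -/
def unexplored (X : Finset V) (A : Finset (V × V)) : Finset (V × V) :=
  A.filter fun q => ¬ (q.1 ∈ X ∧ q.2 ∈ X)

/-- The total weight of the unexplored active pairs. -/
def load (ω : Sym2 V → Bool) (X : Finset V) (A : Finset (V × V)) : ℕ :=
  ∑ q ∈ unexplored X A, pairWeight ω X q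

/-- The exposed vertices forming an active pair with `z`. -/
def partners (X : Finset V) (A : Finset (V × V)) (z : V) : Finset V :=
  X.filter fun a => (z, a) ∈ A

lemma mem_partners {X : Finset V} {A : Finset (V × V)} {z a : V} :
    a ∈ partners X A z ↔ a ∈ X ∧ (z, a) ∈ A := by
  simp [partners]

lemma AgreeOn.commonNbrs_eq {ω ω' : Sym2 V → Bool} {X : Finset V} (hω : AgreeOn X ω ω') (s t : V) :
    commonNbrs ω X s t = commonNbrs ω' X s t := by
  ext x
  simp only [mem_commonNbrs]
  refine and_congr_right fun hx => ?_
  rw [hω.edgeOn_right hx, hω.edgeOn_right hx]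

lemma AgreeOn.nbrsIn_eq {ω ω' : Sym2 V → Bool} {X : Finset V} (hω : AgreeOn X ω ω') (v : V) :
    nbrsIn ω X v = nbrsIn ω' X v := by
  ext x
  simp only [mem_nbrsIn]
  refine and_congr_right fun hx => ?_
  rw [hω.edgeOn_right hx]

lemma AgreeOn.commonNbrs_eq_filter {ω ω' : Sym2 V → Bool} {X : Finset V} {a : V}
    (hω : AgreeOn X ω ω') (ha : a ∈ X) (Y : Finset V) (z : V) :
    commonNbrs ω Y z a = (nbrsIn ω' Y a).filter fun w => EdgeOn ω z w := by
  ext w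
  simp only [mem_commonNbrs, mem_nbrsIn, Finset.mem_filter, hω.edgeOn_left ha]
  tauto

lemma AgreeOn.load_eq {ω ω' : Sym2 V → Bool} {X : Finset V} (hω : AgreeOn X ω ω')
    (A : Finset (V × V)) : load ω X A = load ω' X A :=
  Finset.sum_congr rfl fun q _ => by rw [pairWeight, pairWeight, hω.commonNbrs_eq]

lemma Exploration.load_explored {ω : Sym2 V → Bool} {X S : Finset V} {A : Finset (V × V)} {r : ℕ}
    {z : V} (h : Exploration ω X S A r) (hzX : z ∉ X) :
    ∑ q ∈ unexplored (insert z X) A, pairWeight ω X q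
      + ∑ a ∈ partners X A z, 2 * pairWeight ω X (z, a) ≤ load ω X A := by
  have hd1 : Disjoint ((partners X A z).image fun a => (z, a))
      ((partners X A z).image fun a => (a, z)) := by
    rw [Finset.disjoint_left]
    rintro q hq hq'
    obtain ⟨a, ha, rfl⟩ := Finset.mem_image.1 hq
    obtain ⟨b, hb, hab⟩ := Finset.mem_image.1 hq'
    simp only [Prod.mk.injEq] at hab
    exact hzX (hab.1 ▸ (mem_partners.1 hb).1)
  have hd2 : Disjoint (unexplored (insert z X) A) (((partners X A z).image fun a => (z, a)) ∪
      ((partners X A z).image fun a => (a, z))) := by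
    rw [Finset.disjoint_left]
    rintro q hq hq'
    refine (Finset.mem_filter.1 hq).2 ?_
    rcases Finset.mem_union.1 hq' with hq' | hq' <;>
      obtain ⟨a, ha, rfl⟩ := Finset.mem_image.1 hq' <;>
      simp [(mem_partners.1 ha).1]
  have hsub : unexplored (insert z X) A ∪ (((partners X A z).image fun a => (z, a)) ∪
      ((partners X A z).image fun a => (a, z))) ⊆ unexplored X A := by
    refine Finset.union_subset (fun q hq => ?_) (Finset.union_subset (fun q hq => ?_)
      (fun q hq => ?_))
    · obtain ⟨h1, h2⟩ := Finset.mem_filter.1 hq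
      exact Finset.mem_filter.2 ⟨h1, fun h3 => h2
        ⟨Finset.mem_insert_of_mem h3.1, Finset.mem_insert_of_mem h3.2⟩⟩
    · obtain ⟨a, ha, rfl⟩ := Finset.mem_image.1 hq
      exact Finset.mem_filter.2 ⟨(mem_partners.1 ha).2, fun h3 => hzX h3.1⟩
    · obtain ⟨a, ha, rfl⟩ := Finset.mem_image.1 hq
      exact Finset.mem_filter.2 ⟨h.symm (mem_partners.1 ha).2, fun h3 => hzX h3.2⟩
  refine le_trans (le_of_eq ?_) (Finset.sum_le_sum_of_subset hsub)
  rw [Finset.sum_union hd2, Finset.sum_union hd1, Finset.sum_image (by simp),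
    Finset.sum_image (by simp), ← Finset.sum_add_distrib]
  congr 1
  refine Finset.sum_congr rfl fun a _ => ?_
  rw [two_mul]
  congr 1
  simp only [pairWeight]
  rw [commonNbrs_comm]

variable [Fintype V]

/-- The vertices whose adjacency to the next exposed vertex would be a surprise: the discovered
unexposed ones, and the undiscovered ones with two exposed neighbours. -/
def surprising (ω : Sym2 V → Bool) (X S : Finset V) : Finset V :=
  (S \ X) ∪ Sᶜ.filter fun w => 2 ≤ (nbrsIn ω X w).card

lemma AgreeOn.surprising_eq {ω ω' : Sym2 V → Bool} {X : Finset V} (hω : AgreeOn X ω ω')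
    (S : Finset V) : surprising ω X S = surprising ω' X S := by
  simp only [surprising, hω.nbrsIn_eq]

/-- The vertices discovered when exposing `z`. -/
def discovered (ω : Sym2 V → Bool) (X S : Finset V) (A : Finset (V × V)) (z : V) : Finset V :=
  (partners X A z).biUnion fun a => commonNbrs ω Sᶜ z a

/-- The active pairs after exposing `z`. -/
def activeAfter (ω : Sym2 V → Bool) (X : Finset V) (A : Finset (V × V)) (z : V) :
    Finset (V × V) :=
  A ∪ (partners X A z).biUnion fun a => (commonNbrs ω Finset.univ z a).offDiag

lemma mem_activeAfter {ω : Sym2 V → Bool} {X : Finset V} {A : Finset (V × V)} {z s t : V} :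
    (s, t) ∈ activeAfter ω X A z ↔ (s, t) ∈ A ∨ ∃ a ∈ X, (z, a) ∈ A ∧ EdgeOn ω z s ∧ EdgeOn ω a s ∧
      EdgeOn ω z t ∧ EdgeOn ω a t ∧ s ≠ t := by
  simp only [activeAfter, Finset.mem_union, Finset.mem_biUnion, mem_partners, Finset.mem_offDiag,
    mem_commonNbrs, Finset.mem_univ, true_and]
  refine or_congr Iff.rfl ⟨?_, ?_⟩
  · rintro ⟨a, ⟨h1, h2⟩, ⟨h3, h4⟩, ⟨h5, h6⟩, h7⟩
    exact ⟨a, h1, h2, h3, h4, h5, h6, h7⟩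
  · rintro ⟨a, h1, h2, h3, h4, h5, h6, h7⟩
    exact ⟨a, ⟨h1, h2⟩, ⟨h3, h4⟩, ⟨h5, h6⟩, h7⟩

namespace Exploration

variable {ω : Sym2 V → Bool} {X S : Finset V} {A : Finset (V × V)} {r L : ℕ} {z : V}

lemma mem_exposed_of_edgeOn (hreg : ∀ w ∈ surprising ω X S, ¬ EdgeOn ω z w)
    {u : V} (hu : u ∈ S) (hzu : EdgeOn ω z u) : u ∈ X := by
  by_contra hX
  exact hreg u (by simp [surprising, hu, hX]) hzu

lemma eq_of_edgeOn_exposed (hreg : ∀ w ∈ surprising ω X S, ¬ EdgeOn ω z w)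
    {w a b : V} (hw : w ∉ S) (hzw : EdgeOn ω z w) (ha : a ∈ X) (hb : b ∈ X) (hwa : EdgeOn ω w a)
    (hwb : EdgeOn ω w b) : a = b := by
  by_contra hab
  refine hreg w ?_ hzw
  simp only [surprising, Finset.mem_union, Finset.mem_filter, Finset.mem_compl]
  refine Or.inr ⟨hw, ?_⟩
  refine le_trans (Finset.card_pair hab).ge (Finset.card_le_card ?_)
  intro x hx
  rcases Finset.mem_insert.1 hx with rfl | hx
  · exact mem_nbrsIn.2 ⟨ha, hwa⟩
  · rw [Finset.mem_singleton.1 hx]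
    exact mem_nbrsIn.2 ⟨hb, hwb⟩

/-- A pair that becomes active contains a newly discovered vertex. -/
lemma not_mem_or_not_mem (h : Exploration ω X S A r)
    (hreg : ∀ w ∈ surprising ω X S, ¬ EdgeOn ω z w) {a s t : V} (hza : (z, a) ∈ A)
    (hzs : EdgeOn ω z s) (has : EdgeOn ω a s) (hzt : EdgeOn ω z t) (hat : EdgeOn ω a t)
    (hst : s ≠ t) (hA : (s, t) ∉ A) : s ∉ S ∨ t ∉ S := by
  by_contra! hc
  exact hA (h.closed hza hst hzs has hzt hat
    (Or.inr ⟨mem_exposed_of_edgeOn hreg hc.1 hzs, mem_exposed_of_edgeOn hreg hc.2 hzt⟩))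

lemma expose (h : Exploration ω X S A r) (hz : z ∈ S) (hzX : z ∉ X)
    (hreg : ∀ w ∈ surprising ω X S, ¬ EdgeOn ω z w)
    (hcod : ∀ u v, u ≠ v → (commonNbrs ω Finset.univ u v).card ≤ L) (hLr : L ≤ r) :
    Exploration ω (insert z X) (S ∪ discovered ω X S A z) (activeAfter ω X A z) r where
  exposed_subset := by
    intro x hx
    rcases Finset.mem_insert.1 hx with rfl | hx
    · exact Finset.mem_union_left _ hz
    · exact Finset.mem_union_left _ (h.exposed_subset hx)
  fst_mem := by
    intro s t hst
    rcases mem_activeAfter.1 hst with hst | ⟨a, ha, hza, hzs, has, -⟩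
    · exact Finset.mem_union_left _ (h.fst_mem hst)
    · by_cases hs : s ∈ S
      · exact Finset.mem_union_left _ hs
      · refine Finset.mem_union_right _ (Finset.mem_biUnion.2 ⟨a, mem_partners.2 ⟨ha, hza⟩, ?_⟩)
        exact mem_commonNbrs.2 ⟨Finset.mem_compl.2 hs, hzs, has⟩
  ne := by
    intro s t hst
    rcases mem_activeAfter.1 hst with hst | ⟨a, ha, hza, hzs, has, -, -, hne⟩
    · exact h.ne hst
    · exact hne
  symm := by
    intro s t hst
    rcases mem_activeAfter.1 hst with hst | ⟨a, ha, hza, hzs, has, hzt, hat, hne⟩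
    · exact mem_activeAfter.2 (Or.inl (h.symm hst))
    · exact mem_activeAfter.2 (Or.inr ⟨a, ha, hza, hzt, hat, hzs, has, hne.symm⟩)
  closed := by
    intro u v s t huv hst hus hvs hut hvt hX
    have new : ∀ {w a s t : V}, w ∉ S → EdgeOn ω z w → EdgeOn ω a w → a ∈ X → (z, a) ∈ A →
        EdgeOn ω w s → EdgeOn ω w t → s ≠ t → s ∈ insert z X → t ∈ insert z X → (s, t) ∈ A := by
      intro w a s t hw hzw haw ha hza hws hwt hne hs ht
      rcases Finset.mem_insert.1 hs with rfl | hs' <;> rcases Finset.mem_insert.1 ht with rfl | ht'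
      · exact absurd rfl hne
      · rwa [eq_of_edgeOn_exposed hreg hw hzw ht' ha hwt haw.symm]
      · rw [eq_of_edgeOn_exposed hreg hw hzw hs' ha hws haw.symm]
        exact h.symm hza
      · exact absurd ((eq_of_edgeOn_exposed hreg hw hzw hs' ha hws haw.symm).trans
          (eq_of_edgeOn_exposed hreg hw hzw ht' ha hwt haw.symm).symm) hne
    have endpoints : (u, v) ∈ A → EdgeOn ω z u → EdgeOn ω z v → u ∈ X ∧ v ∈ X := fun hA hu hv =>
      ⟨mem_exposed_of_edgeOn hreg (h.fst_mem hA) hu, mem_exposed_of_edgeOn hreg (h.snd_mem hA) hv⟩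
    have old : (u, v) ∈ A → (s, t) ∈ activeAfter ω X A z := by
      intro hA
      rcases hX with ⟨hu, hv⟩ | ⟨hs, ht⟩
      · rcases Finset.mem_insert.1 hu with rfl | hu' <;>
          rcases Finset.mem_insert.1 hv with rfl | hv'
        · exact absurd rfl (h.ne hA)
        · exact mem_activeAfter.2 (Or.inr ⟨v, hv', hA, hus, hvs, hut, hvt, hst⟩)
        · exact mem_activeAfter.2 (Or.inr ⟨u, hu', h.symm hA, hvs, hus, hvt, hut, hst⟩)
        · exact mem_activeAfter.2 (Or.inl (h.closed hA hst hus hvs hut hvt (Or.inl ⟨hu', hv'⟩)))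
      · refine mem_activeAfter.2 (Or.inl (h.closed hA hst hus hvs hut hvt ?_))
        rcases Finset.mem_insert.1 hs with rfl | hs' <;>
          rcases Finset.mem_insert.1 ht with rfl | ht'
        · exact absurd rfl hst
        · exact Or.inl (endpoints hA hus.symm hvs.symm)
        · exact Or.inl (endpoints hA hut.symm hvt.symm)
        · exact Or.inr ⟨hs', ht'⟩
    rcases mem_activeAfter.1 huv with huv | ⟨a, ha, hza, hzu, hau, hzv, hav, hne⟩
    · exact old huv
    by_cases hA : (u, v) ∈ A
    · exact old hA
    have hnS := h.not_mem_or_not_mem hreg hza hzu hau hzv hav hne hA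
    have hX' : s ∈ insert z X ∧ t ∈ insert z X := by
      refine hX.resolve_left fun ⟨hu, hv⟩ => ?_
      have : insert z X ⊆ S := Finset.insert_subset hz h.exposed_subset
      exact hnS.elim (fun h' => h' (this hu)) (fun h' => h' (this hv))
    refine mem_activeAfter.2 (Or.inl ?_)
    rcases hnS with h' | h'
    · exact new h' hzu hau ha hza hus hut hst hX'.1 hX'.2
    · exact new h' hzv hav ha hza hvs hvt hst hX'.1 hX'.2
  card_le := by
    intro w hw hwX T hT
    have hwX' : w ∉ X := fun h' => hwX (Finset.mem_insert_of_mem h')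
    by_cases hwS : w ∈ S
    · refine h.card_le w hwS hwX' T fun x hx => ?_
      rcases mem_activeAfter.1 (hT x hx) with h' | ⟨a, -, -, hzw, -⟩
      · exact h'
      · exact absurd (mem_exposed_of_edgeOn hreg hwS hzw) hwX'
    · obtain ⟨a, ha, haw⟩ := Finset.mem_biUnion.1 ((Finset.mem_union.1 hw).resolve_left hwS)
      obtain ⟨haX, hza⟩ := mem_partners.1 ha
      obtain ⟨-, hzw, haw⟩ := mem_commonNbrs.1 haw
      refine le_trans (Finset.card_le_card fun x hx => ?_) ((hcod z a (h.ne hza)).trans hLr)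
      rcases mem_activeAfter.1 (hT x hx) with h' | ⟨b, hb, -, -, hbw, hzx, hbx, -⟩
      · exact absurd (h.fst_mem h') hwS
      · rw [eq_of_edgeOn_exposed hreg hwS hzw haX hb haw.symm hbw.symm]
        exact mem_commonNbrs.2 ⟨Finset.mem_univ _, hzx, hbx⟩

lemma pairWeight_insert (h : Exploration ω X S A r)
    (hreg : ∀ w ∈ surprising ω X S, ¬ EdgeOn ω z w) {q : V × V}
    (hq : q ∈ unexplored (insert z X) A) : pairWeight ω (insert z X) q = pairWeight ω X q := by
  obtain ⟨s, t⟩ := q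
  obtain ⟨hA, hq⟩ := Finset.mem_filter.1 hq
  have : commonNbrs ω (insert z X) s t = commonNbrs ω X s t := by
    refine Finset.filter_insert _ _ _ |>.trans (if_neg fun ⟨h1, h2⟩ => hq ⟨?_, ?_⟩)
    · exact Finset.mem_insert_of_mem (mem_exposed_of_edgeOn hreg (h.fst_mem hA) h1.symm)
    · exact Finset.mem_insert_of_mem (mem_exposed_of_edgeOn hreg (h.snd_mem hA) h2.symm)
  simp only [pairWeight, this]

lemma pairWeight_new (h : Exploration ω X S A r)
    (hreg : ∀ w ∈ surprising ω X S, ¬ EdgeOn ω z w) {q : V × V}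
    (hq : q ∈ activeAfter ω X A z) (hA : q ∉ A) : pairWeight ω (insert z X) q = 2 := by
  obtain ⟨s, t⟩ := q
  obtain ⟨a, ha, hza, hzs, has, hzt, hat, hne⟩ := (mem_activeAfter.1 hq).resolve_left hA
  refine max_eq_left ?_
  have key : ∀ {w}, w ∉ S → EdgeOn ω z w → EdgeOn ω a w → ∀ x ∈ insert z X, EdgeOn ω w x →
      x ∈ ({z, a} : Finset V) := by
    intro w hw hzw haw x hx hwx
    rcases Finset.mem_insert.1 hx with rfl | hx'
    · simp
    · simp [eq_of_edgeOn_exposed hreg hw hzw hx' ha hwx haw.symm]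
  refine le_trans (Finset.card_le_card (t := {z, a}) fun x hx => ?_) Finset.card_le_two
  obtain ⟨hx, hsx, htx⟩ := mem_commonNbrs.1 hx
  rcases h.not_mem_or_not_mem hreg hza hzs has hzt hat hne hA with h' | h'
  · exact key h' hzs has x hx hsx
  · exact key h' hzt hat x hx htx

/-- The number of new active pairs created by exposing `z`. -/
lemma card_new_le (h : Exploration ω X S A r)
    (hreg : ∀ w ∈ surprising ω X S, ¬ EdgeOn ω z w) :
    (activeAfter ω X A z \ A).card ≤ ∑ a ∈ partners X A z,
      ((commonNbrs ω Sᶜ z a).offDiag.card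
        + 2 * ((commonNbrs ω X z a).card * (commonNbrs ω Sᶜ z a).card)) := by
  have hsub : activeAfter ω X A z \ A ⊆ (partners X A z).biUnion fun a =>
      (commonNbrs ω Sᶜ z a).offDiag ∪ (commonNbrs ω X z a ×ˢ commonNbrs ω Sᶜ z a
        ∪ commonNbrs ω Sᶜ z a ×ˢ commonNbrs ω X z a) := by
    rintro ⟨s, t⟩ hq
    obtain ⟨hq, hA⟩ := Finset.mem_sdiff.1 hq
    obtain ⟨a, ha, hza, hzs, has, hzt, hat, hne⟩ := (mem_activeAfter.1 hq).resolve_left hA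
    have hor := h.not_mem_or_not_mem hreg hza hzs has hzt hat hne hA
    have hs : s ∈ S → s ∈ X := fun h' => mem_exposed_of_edgeOn hreg h' hzs
    have ht : t ∈ S → t ∈ X := fun h' => mem_exposed_of_edgeOn hreg h' hzt
    refine Finset.mem_biUnion.2 ⟨a, mem_partners.2 ⟨ha, hza⟩, ?_⟩
    simp only [Finset.mem_union, Finset.mem_offDiag, Finset.mem_product, mem_commonNbrs,
      Finset.mem_compl]
    tauto
  refine (Finset.card_le_card hsub).trans (Finset.card_biUnion_le.trans ?_)
  refine Finset.sum_le_sum fun a _ => ?_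
  refine (Finset.card_union_le _ _).trans (Nat.add_le_add_left ?_ _)
  refine (Finset.card_union_le _ _).trans (le_of_eq ?_)
  rw [Finset.card_product, Finset.card_product]
  ring

lemma load_expose_le (h : Exploration ω X S A r) (hzX : z ∉ X)
    (hreg : ∀ w ∈ surprising ω X S, ¬ EdgeOn ω z w) :
    load ω (insert z X) (activeAfter ω X A z)
      + ∑ a ∈ partners X A z, 2 * pairWeight ω X (z, a)
      ≤ load ω X A + 2 * ∑ a ∈ partners X A z, ((commonNbrs ω Sᶜ z a).offDiag.card
        + 2 * ((commonNbrs ω X z a).card * (commonNbrs ω Sᶜ z a).card)) := by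
  have hsub : unexplored (insert z X) (activeAfter ω X A z)
      ⊆ unexplored (insert z X) A ∪ (activeAfter ω X A z \ A) := by
    intro q hq
    obtain ⟨h1, h2⟩ := Finset.mem_filter.1 hq
    by_cases hA : q ∈ A
    · exact Finset.mem_union_left _ (Finset.mem_filter.2 ⟨hA, h2⟩)
    · exact Finset.mem_union_right _ (Finset.mem_sdiff.2 ⟨h1, hA⟩)
  have hload : load ω (insert z X) (activeAfter ω X A z)
      ≤ ∑ q ∈ unexplored (insert z X) A, pairWeight ω X q
        + (activeAfter ω X A z \ A).card * 2 := by
    refine (Finset.sum_le_sum_of_subset hsub).trans ?_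
    rw [Finset.sum_union]
    · refine add_le_add (le_of_eq ?_) (le_of_eq ?_)
      · exact Finset.sum_congr rfl fun q hq => h.pairWeight_insert hreg hq
      · rw [← smul_eq_mul, ← Finset.sum_const]
        exact Finset.sum_congr rfl fun q hq =>
          h.pairWeight_new hreg (Finset.mem_sdiff.1 hq).1 (Finset.mem_sdiff.1 hq).2
    · rw [Finset.disjoint_left]
      exact fun q hq hq' => (Finset.mem_sdiff.1 hq').2 (Finset.mem_filter.1 hq).1
  have := h.load_explored hzX
  have := h.card_new_le hreg
  omega

/-- The state in which all pairs of discovered vertices are active. -/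
lemma offDiag (hXS : X ⊆ S) (hS : ∀ x ∈ X, ∀ y ∈ X, x ≠ y → commonNbrs ω Finset.univ x y ⊆ S)
    (hr : S.card ≤ r) : Exploration ω X S S.offDiag r where
  exposed_subset := hXS
  fst_mem := fun h => (Finset.mem_offDiag.1 h).1
  ne := fun h => (Finset.mem_offDiag.1 h).2.2
  symm := fun h => by
    obtain ⟨h1, h2, h3⟩ := Finset.mem_offDiag.1 h
    exact Finset.mem_offDiag.2 ⟨h2, h1, h3.symm⟩
  card_le := fun z _ _ T hT =>
    (Finset.card_le_card fun a ha => (Finset.mem_offDiag.1 (hT a ha)).2.1).trans hr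
  closed := by
    intro u v s t huv hst hus hvs hut hvt hX
    rcases hX with ⟨hu, hv⟩ | ⟨hs, ht⟩
    · have := hS u hu v hv (Finset.mem_offDiag.1 huv).2.2
      exact Finset.mem_offDiag.2 ⟨this (mem_commonNbrs.2 ⟨Finset.mem_univ _, hus, hvs⟩),
        this (mem_commonNbrs.2 ⟨Finset.mem_univ _, hut, hvt⟩), hst⟩
    · exact Finset.mem_offDiag.2 ⟨hXS hs, hXS ht, hst⟩

end Exploration

end Exploration

/-! ### Weighted sums over cylinders -/

section Phase

variable {V : Type*} [DecidableEq V] [Fintype V]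

/-- The sum of `f` over a cylinder, weighted by the configuration weights. -/
def cylinderSum (p : ℝ) (X : Finset V) (ω₀ : Sym2 V → Bool) (f : (Sym2 V → Bool) → ℝ) : ℝ :=
  ∑ ω ∈ edgeCylinder X ω₀, configWeight p ω * f ω

section CylinderSum

variable {p : ℝ} {X S : Finset V} {ω₀ : Sym2 V → Bool} {f g : (Sym2 V → Bool) → ℝ} {z a : V}

lemma cylinderSum_mono (h0 : 0 ≤ p) (h1 : p ≤ 1) (h : ∀ ω, AgreeOn X ω ω₀ → f ω ≤ g ω) :
    cylinderSum p X ω₀ f ≤ cylinderSum p X ω₀ g :=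
  Finset.sum_le_sum fun ω hω =>
    mul_le_mul_of_nonneg_left (h ω (mem_edgeCylinder.1 hω)) (configWeight_nonneg h0 h1 ω)

lemma cylinderSum_congr (h : ∀ ω, AgreeOn X ω ω₀ → f ω = g ω) :
    cylinderSum p X ω₀ f = cylinderSum p X ω₀ g :=
  Finset.sum_congr rfl fun ω hω => by rw [h ω (mem_edgeCylinder.1 hω)]

lemma cylinderSum_add : cylinderSum p X ω₀ (fun ω => f ω + g ω)
    = cylinderSum p X ω₀ f + cylinderSum p X ω₀ g := by
  simp only [cylinderSum, mul_add, Finset.sum_add_distrib]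

lemma cylinderSum_const_mul (c : ℝ) :
    cylinderSum p X ω₀ (fun ω => c * f ω) = c * cylinderSum p X ω₀ f := by
  simp only [cylinderSum, Finset.mul_sum]
  exact Finset.sum_congr rfl fun _ _ => by ring

lemma cylinderSum_const (c : ℝ) :
    cylinderSum p X ω₀ (fun _ => c) = c * cylinderMass p X ω₀ := by
  simp only [cylinderSum, cylinderMass, Finset.mul_sum]
  exact Finset.sum_congr rfl fun _ _ => by ring

lemma cylinderSum_sum {ι : Type*} (s : Finset ι) (F : ι → (Sym2 V → Bool) → ℝ) :
    cylinderSum p X ω₀ (fun ω => ∑ i ∈ s, F i ω) = ∑ i ∈ s, cylinderSum p X ω₀ (F i) := by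
  simp only [cylinderSum, Finset.mul_sum]
  exact Finset.sum_comm

lemma cylinderSum_card_commonNbrs (hXS : X ⊆ S) (hz : z ∈ S) (hzX : z ∉ X) (ha : a ∈ X) :
    cylinderSum p X ω₀ (fun ω => ((commonNbrs ω Sᶜ z a).card : ℝ))
      = (nbrsIn ω₀ Sᶜ a).card * p * cylinderMass p X ω₀ := by
  rw [cylinderSum_congr (g := fun ω => ∑ w ∈ nbrsIn ω₀ Sᶜ a, if EdgeOn ω z w then 1 else 0)
    fun ω hω => by rw [hω.commonNbrs_eq_filter ha, Finset.sum_boole], cylinderSum_sum,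
    mul_assoc, ← nsmul_eq_mul]
  refine Finset.sum_eq_card_nsmul fun w hw => ?_
  have hwS : w ∉ S := Finset.mem_compl.1 (mem_nbrsIn.1 hw).1
  exact sum_edgeCylinder_edgeOn p X ω₀ hzX (fun h => hwS (hXS h)) fun h => hwS (h ▸ hz)

lemma cylinderSum_card_offDiag (hXS : X ⊆ S) (hz : z ∈ S) (hzX : z ∉ X) (ha : a ∈ X) :
    cylinderSum p X ω₀ (fun ω => ((commonNbrs ω Sᶜ z a).offDiag.card : ℝ))
      = (nbrsIn ω₀ Sᶜ a).offDiag.card * p ^ 2 * cylinderMass p X ω₀ := by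
  have key : ∀ ω, AgreeOn X ω ω₀ → (commonNbrs ω Sᶜ z a).offDiag
      = (nbrsIn ω₀ Sᶜ a).offDiag.filter fun q => EdgeOn ω z q.1 ∧ EdgeOn ω z q.2 := by
    intro ω hω
    ext ⟨w, w'⟩
    simp only [hω.commonNbrs_eq_filter ha, Finset.mem_offDiag, Finset.mem_filter]
    tauto
  rw [cylinderSum_congr (g := fun ω => ∑ q ∈ (nbrsIn ω₀ Sᶜ a).offDiag,
    if EdgeOn ω z q.1 ∧ EdgeOn ω z q.2 then 1 else 0)
    fun ω hω => by rw [key ω hω, Finset.sum_boole], cylinderSum_sum,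
    mul_assoc, ← nsmul_eq_mul]
  refine Finset.sum_eq_card_nsmul fun q hq => ?_
  obtain ⟨h1, h2, h3⟩ := Finset.mem_offDiag.1 hq
  have hS1 : q.1 ∉ S := Finset.mem_compl.1 (mem_nbrsIn.1 h1).1
  have hS2 : q.2 ∉ S := Finset.mem_compl.1 (mem_nbrsIn.1 h2).1
  exact sum_edgeCylinder_edgeOn_edgeOn p X ω₀ hzX (fun h => hS1 (hXS h)) (fun h => hS2 (hXS h))
    (fun h => hS1 (h ▸ hz)) (fun h => hS2 (h ▸ hz)) h3

lemma cylinderSum_exists_edgeOn_le (h0 : 0 ≤ p) (h1 : p ≤ 1) {T : Finset V} (hzX : z ∉ X)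
    (hT : ∀ w ∈ T, w ∉ X) :
    cylinderSum p X ω₀ (fun ω => if ∃ w ∈ T, EdgeOn ω z w then 1 else 0)
      ≤ T.card * p * cylinderMass p X ω₀ := by
  have h2 : cylinderSum p X ω₀ (fun ω => if ∃ w ∈ T, EdgeOn ω z w then 1 else 0)
      ≤ cylinderSum p X ω₀ (fun ω => ∑ w ∈ T, if EdgeOn ω z w then 1 else 0) := by
    refine cylinderSum_mono h0 h1 fun ω _ => ?_
    have hnn : ∀ w ∈ T, (0 : ℝ) ≤ if EdgeOn ω z w then 1 else 0 := fun w _ => by positivity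
    split_ifs with h
    · obtain ⟨w, hw, hzw⟩ := h
      refine le_trans (le_of_eq ?_) (Finset.single_le_sum hnn hw)
      rw [if_pos hzw]
    · exact Finset.sum_nonneg hnn
  refine h2.trans ?_
  rw [cylinderSum_sum, mul_assoc, ← nsmul_eq_mul]
  refine Finset.sum_le_card_nsmul _ _ _ fun w hw => ?_
  by_cases hzw : z = w
  · have : cylinderSum p X ω₀ (fun ω => if EdgeOn ω z w then 1 else 0) = 0 := by
      simp [cylinderSum, hzw, EdgeOn]
    rw [this]
    exact mul_nonneg h0 (cylinderMass_nonneg h0 h1 _ _)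
  · exact (sum_edgeCylinder_edgeOn p X ω₀ hzX (hT w hw) hzw).le

end CylinderSum

/-! ### One phase of the exploration -/

/-- All codegrees are at most `L` and all degrees are at most `μ / p`. -/
structure IsTypical (p μ : ℝ) (L : ℕ) (ω : Sym2 V → Bool) : Prop where
  codegree : ∀ u v, u ≠ v → (commonNbrs ω Finset.univ u v).card ≤ L
  degree : ∀ v, ((nbrsIn ω Finset.univ v).card : ℝ) * p ≤ μ

lemma card_biUnion_commonNbrs_le {ω : Sym2 V → Bool} {L : ℕ} (X : Finset V)
    (hcod : ∀ u v, u ≠ v → (commonNbrs ω Finset.univ u v).card ≤ L) :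
    (X.offDiag.biUnion fun q => commonNbrs ω Finset.univ q.1 q.2).card ≤ X.card ^ 2 * L := by
  refine (Finset.card_biUnion_le_card_mul _ _ L fun q hq =>
    hcod _ _ (Finset.mem_offDiag.1 hq).2.2).trans (Nat.mul_le_mul_right _ ?_)
  rw [Finset.offDiag_card, sq]
  exact Nat.sub_le _ _

lemma card_surprising_le {ω : Sym2 V → Bool} {X S : Finset V} {L : ℕ}
    (hcod : ∀ u v, u ≠ v → (commonNbrs ω Finset.univ u v).card ≤ L) :
    (surprising ω X S).card ≤ S.card + X.card ^ 2 * L := by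
  refine (Finset.card_union_le _ _).trans (add_le_add (Finset.card_le_card Finset.sdiff_subset)
    ((Finset.card_le_card fun w hw => ?_).trans (card_biUnion_commonNbrs_le X hcod)))
  obtain ⟨a, ha, b, hb, hab⟩ := Finset.one_lt_card.1 (Finset.mem_filter.1 hw).2
  rw [mem_nbrsIn] at ha hb
  exact Finset.mem_biUnion.2 ⟨(a, b), Finset.mem_offDiag.2 ⟨ha.1, hb.1, hab⟩,
    mem_commonNbrs.2 ⟨Finset.mem_univ _, ha.2.symm, hb.2.symm⟩⟩

lemma not_mem_of_mem_surprising {ω : Sym2 V → Bool} {X S : Finset V} (hXS : X ⊆ S) {w : V}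
    (hw : w ∈ surprising ω X S) : w ∉ X := by
  rcases Finset.mem_union.1 hw with h | h
  · exact (Finset.mem_sdiff.1 h).2
  · exact fun hX => Finset.mem_compl.1 (Finset.mem_filter.1 h).1 (hXS hX)

/-- A bound `Ψ` for the conditional probability of `B` given the edges meeting `X`, uniform over
the sets `X` contained in a set of size at most `s` with some closure properties. -/
def ResetBound (p : ℝ) (B : (Sym2 V → Bool) → Prop) [DecidablePred B] (x y : V) (s : ℕ)
    (Ψ : ℝ) : Prop :=
  ∀ (X S : Finset V) (ω : Sym2 V → Bool), B ω → X ⊆ S → x ∈ S → y ∈ S →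
    (∀ u ∈ X, ∀ v ∈ X, u ≠ v → commonNbrs ω Finset.univ u v ⊆ S) → S.card ≤ s →
    eventMass p B X ω ≤ cylinderMass p X ω * Ψ

/-- A bound for the increase of the exponent of the potential when `z` is exposed. -/
def gain (α β : ℝ) (ω : Sym2 V → Bool) (X S : Finset V) (A : Finset (V × V)) (z : V) : ℝ :=
  ∑ a ∈ partners X A z, (2 * α * ((commonNbrs ω Sᶜ z a).offDiag.card
    + 2 * ((commonNbrs ω X z a).card * (commonNbrs ω Sᶜ z a).card))
    + β * (commonNbrs ω Sᶜ z a).card)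

lemma gain_nonneg {α β : ℝ} (hα : 0 ≤ α) (hβ : 0 ≤ β) (ω : Sym2 V → Bool) (X S : Finset V)
    (A : Finset (V × V)) (z : V) : 0 ≤ gain α β ω X S A z :=
  Finset.sum_nonneg fun _ _ => by positivity

lemma AgreeOn.gain_eq {X : Finset V} {z : V} {ω ω' : Sym2 V → Bool}
    (hω : AgreeOn (insert z X) ω ω') (α β : ℝ) (S : Finset V) (A : Finset (V × V)) :
    gain α β ω X S A z = gain α β ω' X S A z := by
  refine Finset.sum_congr rfl fun a ha => ?_
  have haX := Finset.mem_insert_of_mem (a := a) (b := z) (mem_partners.1 ha).1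
  have key : ∀ Y, commonNbrs ω Y z a = commonNbrs ω' Y z a := fun Y => by
    simp only [commonNbrs, hω.edgeOn_left haX, hω.edgeOn_left (Finset.mem_insert_self z X)]
  rw [key, key]

lemma Exploration.gain_le {ω : Sym2 V → Bool} {X S : Finset V} {A : Finset (V × V)} {r L : ℕ}
    {z : V} {α β : ℝ} (hα : 0 ≤ α) (hβ : 0 ≤ β) (h : Exploration ω X S A r) (hz : z ∈ S)
    (hzX : z ∉ X) (hcod : ∀ u v, u ≠ v → (commonNbrs ω Finset.univ u v).card ≤ L) :
    gain α β ω X S A z ≤ r * (6 * α * L ^ 2 + β * L) := by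
  refine (Finset.sum_le_card_nsmul _ _ (6 * α * L ^ 2 + β * L) fun a ha => ?_).trans ?_
  · have hc : ∀ Y, (commonNbrs ω Y z a).card ≤ L := fun Y =>
      (Finset.card_le_card (commonNbrs_mono ω (Finset.subset_univ Y) z a)).trans
        (hcod z a (h.ne (mem_partners.1 ha).2))
    have h1 : ((commonNbrs ω X z a).card : ℝ) ≤ L := by exact_mod_cast hc X
    have h2 : ((commonNbrs ω Sᶜ z a).card : ℝ) ≤ L := by exact_mod_cast hc Sᶜ
    have h3 : ((commonNbrs ω Sᶜ z a).offDiag.card : ℝ) ≤ L ^ 2 := by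
      have : (commonNbrs ω Sᶜ z a).offDiag.card ≤ L ^ 2 := by
        rw [Finset.offDiag_card, sq]
        exact (Nat.sub_le _ _).trans (Nat.mul_le_mul (hc _) (hc _))
      exact_mod_cast this
    calc _ ≤ 2 * α * ((L : ℝ) ^ 2 + 2 * ((L : ℝ) * L)) + β * L := by gcongr
      _ = _ := by ring
  · rw [nsmul_eq_mul]
    refine mul_le_mul_of_nonneg_right ?_ (by positivity)
    exact_mod_cast h.card_le z hz hzX _ fun a ha => (mem_partners.1 ha).2

lemma cylinderSum_gain_le {p μ α β : ℝ} (h0 : 0 ≤ p) (h1 : p ≤ 1) (hα : 0 ≤ α)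
    (hβ : 0 ≤ β) {X S : Finset V} (hXS : X ⊆ S) {A : Finset (V × V)} {z : V} (hz : z ∈ S)
    (hzX : z ∉ X) {ω₀ : Sym2 V → Bool}
    (hdeg : ∀ v, ((nbrsIn ω₀ Finset.univ v).card : ℝ) * p ≤ μ) :
    cylinderSum p X ω₀ (fun ω => gain α β ω X S A z) ≤ cylinderMass p X ω₀ *
      ∑ a ∈ partners X A z,
        (2 * α * (μ ^ 2 + 2 * (commonNbrs ω₀ X z a).card * μ) + β * μ) := by
  have hm := cylinderMass_nonneg h0 h1 X ω₀
  unfold gain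
  rw [cylinderSum_sum, Finset.mul_sum]
  refine Finset.sum_le_sum fun a ha => ?_
  have haX := (mem_partners.1 ha).1
  have hd : ((nbrsIn ω₀ Sᶜ a).card : ℝ) * p ≤ μ := by
    refine le_trans (mul_le_mul_of_nonneg_right ?_ h0) (hdeg a)
    exact_mod_cast Finset.card_le_card (Finset.filter_subset_filter _ (Finset.subset_univ Sᶜ))
  have hd0 : 0 ≤ ((nbrsIn ω₀ Sᶜ a).card : ℝ) * p := by positivity
  have hd2 : ((nbrsIn ω₀ Sᶜ a).offDiag.card : ℝ) * p ^ 2 ≤ μ ^ 2 := by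
    calc ((nbrsIn ω₀ Sᶜ a).offDiag.card : ℝ) * p ^ 2
        ≤ ((nbrsIn ω₀ Sᶜ a).card * (nbrsIn ω₀ Sᶜ a).card : ℝ) * p ^ 2 := by
          refine mul_le_mul_of_nonneg_right ?_ (by positivity)
          rw [Finset.offDiag_card]
          exact_mod_cast Nat.sub_le _ _
      _ = ((nbrsIn ω₀ Sᶜ a).card * p) ^ 2 := by ring
      _ ≤ μ ^ 2 := by gcongr
  rw [cylinderSum_congr (g := fun ω => 2 * α * ((commonNbrs ω Sᶜ z a).offDiag.card : ℝ)
    + (4 * α * (commonNbrs ω₀ X z a).card + β) * ((commonNbrs ω Sᶜ z a).card : ℝ))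
    fun ω hω => by rw [hω.commonNbrs_eq]; ring, cylinderSum_add, cylinderSum_const_mul,
    cylinderSum_const_mul, cylinderSum_card_offDiag hXS hz hzX haX,
    cylinderSum_card_commonNbrs hXS hz hzX haX]
  calc _ = cylinderMass p X ω₀ * (2 * α * ((nbrsIn ω₀ Sᶜ a).offDiag.card * p ^ 2)
        + (4 * α * (commonNbrs ω₀ X z a).card + β) * ((nbrsIn ω₀ Sᶜ a).card * p)) := by ring
    _ ≤ cylinderMass p X ω₀ * (2 * α * μ ^ 2
        + (4 * α * (commonNbrs ω₀ X z a).card + β) * μ) := by gcongr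
    _ = _ := by ring

end Phase

section Potential

variable {V : Type*} [DecidableEq V] [Fintype V] {p α β η μ Ψ : ℝ} {cap r L : ℕ}
  {B : (Sym2 V → Bool) → Prop} [DecidablePred B] {x y : V}

/-- The potential of an exploration state. -/
def potential (α β : ℝ) (cap : ℕ) (ω : Sym2 V → Bool) (X S : Finset V) (A : Finset (V × V)) : ℝ :=
  Real.exp (α * load ω X A + β * ((S.card : ℝ) - cap))

/-- The weight of the pairs explored when `z` is exposed. -/
def explored (ω : Sym2 V → Bool) (X : Finset V) (A : Finset (V × V)) (z : V) : ℝ :=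
  ∑ a ∈ partners X A z, 2 * (pairWeight ω X (z, a) : ℝ)

lemma exp_le_one_add_mul {t : ℝ} (h0 : 0 ≤ t) (hη : t ≤ η) (h1 : η ≤ 1) :
    Real.exp t ≤ 1 + (1 + η) * t := by
  have h := Real.abs_exp_sub_one_sub_id_le (x := t) (by rw [abs_of_nonneg h0]; linarith)
  have h' := (abs_le.1 h).2
  nlinarith

lemma Exploration.potential_expose_le (hα : 0 ≤ α) (hβ : 0 ≤ β) {ω : Sym2 V → Bool}
    {X S : Finset V} {A : Finset (V × V)} {z : V} (h : Exploration ω X S A r) (hzX : z ∉ X)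
    (hreg : ∀ w ∈ surprising ω X S, ¬ EdgeOn ω z w) :
    potential α β cap ω (insert z X) (S ∪ discovered ω X S A z) (activeAfter ω X A z)
      ≤ potential α β cap ω X S A
        * (Real.exp (-(α * explored ω X A z)) * Real.exp (gain α β ω X S A z)) := by
  rw [potential, potential, ← Real.exp_add, ← Real.exp_add]
  refine Real.exp_le_exp.2 ?_
  have h1 : (load ω (insert z X) (activeAfter ω X A z) : ℝ) + explored ω X A z
      ≤ load ω X A + 2 * ∑ a ∈ partners X A z, (((commonNbrs ω Sᶜ z a).offDiag.card : ℝ)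
        + 2 * ((commonNbrs ω X z a).card * (commonNbrs ω Sᶜ z a).card)) := by
    have := h.load_expose_le hzX hreg
    rw [explored]
    exact_mod_cast this
  have h2 : (((S ∪ discovered ω X S A z).card : ℕ) : ℝ)
      ≤ S.card + ∑ a ∈ partners X A z, ((commonNbrs ω Sᶜ z a).card : ℝ) := by
    exact_mod_cast (Finset.card_union_le _ _).trans
      (Nat.add_le_add_left Finset.card_biUnion_le _)
  have h3 : gain α β ω X S A z = α * (2 * ∑ a ∈ partners X A z,
      (((commonNbrs ω Sᶜ z a).offDiag.card : ℝ)
        + 2 * ((commonNbrs ω X z a).card * (commonNbrs ω Sᶜ z a).card)))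
      + β * ∑ a ∈ partners X A z, ((commonNbrs ω Sᶜ z a).card : ℝ) := by
    rw [gain, Finset.sum_add_distrib, ← Finset.mul_sum, ← Finset.mul_sum]
    ring
  have h4 := mul_le_mul_of_nonneg_left h1 hα
  have h5 := mul_le_mul_of_nonneg_left h2 hβ
  rw [h3]
  linarith

/-- The conditional probability of `B` is bounded by the potential plus an error accounting for the
surprises. -/
theorem Exploration.eventMass_le (h0 : 0 ≤ p) (h1 : p ≤ 1) (hα : 0 ≤ α) (hβ : 0 ≤ β)
    (hη : 0 ≤ η) (hη1 : η ≤ 1) (hΨ : 0 ≤ Ψ) (hLr : L ≤ r)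
    (hB : ∀ ω, B ω → IsTypical p μ L ω)
    (hclosed : ∀ ω, B ω → ∀ (S : Finset V) (A : Finset (V × V)), Exploration ω S S A r →
      (x, y) ∈ A → cap < S.card)
    (hreset : ResetBound p B x y (cap + cap ^ 2 * L) Ψ)
    (hsize : r * (6 * α * L ^ 2 + β * L) ≤ η)
    (hdrift : ∀ c : ℕ, (1 + η) * (2 * α * (μ ^ 2 + 2 * c * μ) + β * μ) ≤ 2 * α * max 2 c)
    {X S : Finset V} {A : Finset (V × V)} {ω₀ : Sym2 V → Bool} (h : Exploration ω₀ X S A r)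
    (hω₀ : B ω₀) (hxy : (x, y) ∈ A) :
    eventMass p B X ω₀ ≤ cylinderMass p X ω₀ * (potential α β cap ω₀ X S A
      + ((cap - X.card : ℕ) : ℝ) * ((cap + cap ^ 2 * L : ℕ) * p * Ψ)) := by
  induction hk : Xᶜ.card using Nat.strong_induction_on generalizing X S A ω₀ with
  | _ k ih =>
  have hm := cylinderMass_nonneg h0 h1 X ω₀
  set q : ℝ := (cap + cap ^ 2 * L : ℕ) * p * Ψ with hq
  have hq0 : 0 ≤ q := by positivity
  rcases le_or_gt cap S.card with hcap | hcap
  · refine (eventMass_le_cylinderMass h0 h1 B X ω₀).trans (le_mul_of_one_le_right hm ?_)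
    have : (1 : ℝ) ≤ potential α β cap ω₀ X S A := by
      refine Real.one_le_exp (add_nonneg (by positivity) (mul_nonneg hβ ?_))
      rw [sub_nonneg]
      exact_mod_cast hcap
    have : 0 ≤ ((cap - X.card : ℕ) : ℝ) * q := by positivity
    linarith
  obtain ⟨z, hz⟩ : (S \ X).Nonempty := by
    rw [Finset.nonempty_iff_ne_empty]
    intro hSX
    have hXS : X = S := h.exposed_subset.antisymm (Finset.sdiff_eq_empty_iff_subset.1 hSX)
    subst hXS
    exact absurd (hclosed ω₀ hω₀ _ _ h hxy) hcap.not_gt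
  obtain ⟨hzS, hzX⟩ := Finset.mem_sdiff.1 hz
  have hXcap : X.card < cap := (Finset.card_le_card h.exposed_subset).trans_lt hcap
  have hXcap' : ((cap - X.card : ℕ) : ℝ) = ((cap - (insert z X).card : ℕ) : ℝ) + 1 := by
    rw [Finset.card_insert_of_notMem hzX]
    have : cap - X.card = cap - (X.card + 1) + 1 := by omega
    exact_mod_cast this
  set T := surprising ω₀ X S with hT
  set Φ := potential α β cap ω₀ X S A with hΦ
  have hΦ0 : 0 ≤ Φ := (Real.exp_pos _).le
  set D := explored ω₀ X A z with hD
  set m : ℝ := ((cap - (insert z X).card : ℕ) : ℝ) with hm'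
  have hm0 : 0 ≤ m := Nat.cast_nonneg _
  set g : (Sym2 V → Bool) → ℝ := fun ω =>
    (Φ * Real.exp (-(α * D)) * (1 + (1 + η) * gain α β ω X S A z) + m * q)
      + Ψ * (if ∃ w ∈ T, EdgeOn ω z w then 1 else 0) with hg
  have hfirst : ∀ ω, 0 ≤ Φ * Real.exp (-(α * D)) * (1 + (1 + η) * gain α β ω X S A z) + m * q := by
    intro ω
    have := gain_nonneg hα hβ ω X S A z
    positivity
  have hTcard : T.card ≤ cap + cap ^ 2 * L :=
    (card_surprising_le (hB _ hω₀).codegree).trans (by gcongr)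
  have hstep : eventMass p B X ω₀ ≤ cylinderSum p X ω₀ g := by
    refine eventMass_le_sum h0 h1 B (Finset.subset_insert z X) ω₀ g (fun ω => ?_)
      (fun ω ω' hω => ?_) (fun ω₁ hω₁ hBω₁ => ?_)
    · exact add_nonneg (hfirst ω) (mul_nonneg hΨ (by positivity))
    · simp only [hg, hω.gain_eq, hω.edgeOn_left (Finset.mem_insert_self z X)]
    · have hm1 := cylinderMass_nonneg h0 h1 (insert z X) ω₁
      have h' := h.congr hω₁.symm
      have hcod := (hB _ hBω₁).codegree
      by_cases hs : ∃ w ∈ T, EdgeOn ω₁ z w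
      · refine le_trans ?_ (mul_le_mul_of_nonneg_left
          (le_add_of_nonneg_left (hfirst ω₁)) hm1)
        rw [if_pos hs, mul_one]
        refine hreset (insert z X) (S ∪ (insert z X).offDiag.biUnion fun q =>
          commonNbrs ω₁ Finset.univ q.1 q.2) ω₁ hBω₁ ?_ ?_ ?_ ?_ ?_
        · exact (Finset.insert_subset hzS h.exposed_subset).trans Finset.subset_union_left
        · exact Finset.mem_union_left _ (h.fst_mem hxy)
        · exact Finset.mem_union_left _ (h.snd_mem hxy)
        · intro u hu v hv huv
          refine Finset.Subset.trans ?_ Finset.subset_union_right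
          exact Finset.subset_biUnion_of_mem (fun q : V × V => commonNbrs ω₁ Finset.univ q.1 q.2)
            (Finset.mem_offDiag.2 ⟨hu, hv, huv⟩ : (u, v) ∈ _)
        · refine (Finset.card_union_le _ _).trans (add_le_add hcap.le
            ((card_biUnion_commonNbrs_le _ hcod).trans ?_))
          rw [Finset.card_insert_of_notMem hzX]
          gcongr
          exact hXcap
      · have hreg : ∀ w ∈ surprising ω₁ X S, ¬ EdgeOn ω₁ z w := by
          rw [hω₁.surprising_eq]
          exact fun w hw hzw => hs ⟨w, hw, hzw⟩
        have hcompl : (insert z X)ᶜ.card < k := by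
          rw [← hk]
          refine Finset.card_lt_card (Finset.compl_ssubset_compl.2 (Finset.ssubset_insert hzX))
        refine (ih _ hcompl (h'.expose hzS hzX hreg hcod hLr) hBω₁
          (Finset.mem_union_left _ hxy) rfl).trans (mul_le_mul_of_nonneg_left ?_ hm1)
        simp only [hg, if_neg hs, mul_zero, add_zero]
        refine add_le_add ((h'.potential_expose_le hα hβ hzX hreg).trans ?_) le_rfl
        have e1 : potential α β cap ω₁ X S A = Φ := by
          rw [hΦ, potential, potential, hω₁.load_eq]
        have e2 : explored ω₁ X A z = D := by
          simp only [hD, explored, pairWeight, hω₁.commonNbrs_eq]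
        rw [e1, e2, mul_assoc]
        gcongr
        exact exp_le_one_add_mul (gain_nonneg hα hβ ω₁ X S A z)
          ((h'.gain_le hα hβ hzS hzX hcod).trans hsize) hη1
  refine hstep.trans ?_
  have hsum : cylinderSum p X ω₀ g = (Φ * Real.exp (-(α * D)) + m * q) * cylinderMass p X ω₀
      + Φ * Real.exp (-(α * D)) * (1 + η) * cylinderSum p X ω₀ (fun ω => gain α β ω X S A z)
      + Ψ * cylinderSum p X ω₀ (fun ω => if ∃ w ∈ T, EdgeOn ω z w then 1 else 0) := by
    rw [← cylinderSum_const, ← cylinderSum_const_mul, ← cylinderSum_const_mul, ← cylinderSum_add,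
      ← cylinderSum_add]
    congr 1
    funext ω
    simp only [hg]
    ring
  have hgain := cylinderSum_gain_le h0 h1 hα hβ h.exposed_subset hzS hzX (A := A)
    (hB _ hω₀).degree
  have hsurp := cylinderSum_exists_edgeOn_le (ω₀ := ω₀) h0 h1 hzX
    (fun w hw => not_mem_of_mem_surprising h.exposed_subset hw : ∀ w ∈ T, w ∉ X)
  have hdr : (1 + η) * ∑ a ∈ partners X A z,
      (2 * α * (μ ^ 2 + 2 * (commonNbrs ω₀ X z a).card * μ) + β * μ) ≤ α * D := by
    rw [hD, explored, Finset.mul_sum, Finset.mul_sum]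
    refine Finset.sum_le_sum fun a _ => (hdrift _).trans (le_of_eq ?_)
    rw [pairWeight]
    push_cast
    ring
  have hexp : Real.exp (-(α * D)) * (1 + α * D) ≤ 1 := by
    rw [Real.exp_neg, inv_mul_le_iff₀ (Real.exp_pos _), mul_one, add_comm]
    exact Real.add_one_le_exp _
  set G := ∑ a ∈ partners X A z,
      (2 * α * (μ ^ 2 + 2 * (commonNbrs ω₀ X z a).card * μ) + β * μ) with hG
  have hTcard' : (T.card : ℝ) ≤ ((cap + cap ^ 2 * L : ℕ) : ℝ) := by exact_mod_cast hTcard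
  rw [hsum, hXcap']
  calc _ ≤ (Φ * Real.exp (-(α * D)) + m * q) * cylinderMass p X ω₀
        + Φ * Real.exp (-(α * D)) * (1 + η) * (cylinderMass p X ω₀ * G)
        + Ψ * (((cap + cap ^ 2 * L : ℕ) : ℝ) * p * cylinderMass p X ω₀) := by
        gcongr
        exact hsurp.trans (by gcongr)
    _ = cylinderMass p X ω₀ * (Φ * (Real.exp (-(α * D)) * (1 + (1 + η) * G)) + m * q + q) := by
        rw [hq]; ring
    _ ≤ cylinderMass p X ω₀ * (Φ * (Real.exp (-(α * D)) * (1 + α * D)) + m * q + q) := by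
        gcongr
    _ ≤ cylinderMass p X ω₀ * (Φ * 1 + m * q + q) := by gcongr
    _ = _ := by ring

/-- Restarting the exploration with all discovered pairs active improves a reset bound. -/
theorem ResetBound.improve {s : ℕ} (h0 : 0 ≤ p) (h1 : p ≤ 1) (hα : 0 ≤ α) (hβ : 0 ≤ β)
    (hη : 0 ≤ η) (hη1 : η ≤ 1) (hΨ : 0 ≤ Ψ) (hs : 2 ≤ s) (hLs : L ≤ s) (hxy : x ≠ y)
    (hB : ∀ ω, B ω → IsTypical p μ L ω)
    (hclosed : ∀ ω, B ω → ∀ (S : Finset V) (A : Finset (V × V)), Exploration ω S S A s →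
      (x, y) ∈ A → cap < S.card)
    (hreset : ResetBound p B x y (cap + cap ^ 2 * L) Ψ)
    (hsize : s * (6 * α * L ^ 2 + β * L) ≤ η)
    (hdrift : ∀ c : ℕ, (1 + η) * (2 * α * (μ ^ 2 + 2 * c * μ) + β * μ) ≤ 2 * α * max 2 c) :
    ResetBound p B x y s (Real.exp (α * s ^ 3 + β * (s - cap))
      + cap * ((cap + cap ^ 2 * L : ℕ) * p * Ψ)) := by
  intro X S ω hBω hXS hx hy hS hSs
  refine ((Exploration.offDiag hXS hS hSs).eventMass_le h0 h1 hα hβ hη hη1 hΨ hLs hB hclosed hreset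
    hsize hdrift hBω (Finset.mem_offDiag.2 ⟨hx, hy, hxy⟩)).trans
    (mul_le_mul_of_nonneg_left ?_ (cylinderMass_nonneg h0 h1 X ω))
  have hSs' : (S.card : ℝ) ≤ s := by exact_mod_cast hSs
  have hload : load ω X S.offDiag ≤ s ^ 3 := by
    refine (Finset.sum_le_card_nsmul _ _ s fun q hq => ?_).trans ?_
    · have := (Finset.mem_offDiag.1 (Finset.mem_filter.1 hq).1).2.2
      exact max_le hs ((Finset.card_le_card (commonNbrs_mono ω (Finset.subset_univ X) _ _)).trans
        (((hB _ hBω).codegree _ _ this).trans hLs))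
    · rw [smul_eq_mul, pow_succ]
      refine Nat.mul_le_mul_right _ ((Finset.card_le_card (Finset.filter_subset _ _)).trans ?_)
      rw [Finset.offDiag_card, sq]
      exact (Nat.sub_le _ _).trans (Nat.mul_le_mul hSs hSs)
  have hload' : (load ω X S.offDiag : ℝ) ≤ (s : ℝ) ^ 3 := by exact_mod_cast hload
  refine add_le_add (Real.exp_le_exp.2 ?_) ?_
  · gcongr
  · have : ((cap - X.card : ℕ) : ℝ) ≤ cap := by exact_mod_cast Nat.sub_le _ _
    gcongr

lemma resetBound_one (h0 : 0 ≤ p) (h1 : p ≤ 1) (s : ℕ) : ResetBound p B x y s 1 :=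
  fun X _ ω _ _ _ _ _ _ => by
    rw [mul_one]
    exact eventMass_le_cylinderMass h0 h1 B X ω

lemma ResetBound.mono {s t : ℕ} (h : ResetBound p B x y t Ψ) (hst : s ≤ t) :
    ResetBound p B x y s Ψ :=
  fun X S ω hB hXS hx hy hS hs => h X S ω hB hXS hx hy hS (hs.trans hst)

lemma ResetBound.weaken {s : ℕ} {Ψ' : ℝ} (h0 : 0 ≤ p) (h1 : p ≤ 1) (h : ResetBound p B x y s Ψ)
    (hΨ : Ψ ≤ Ψ') : ResetBound p B x y s Ψ' :=
  fun X S ω hB hXS hx hy hS hs => (h X S ω hB hXS hx hy hS hs).trans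
    (mul_le_mul_of_nonneg_left hΨ (cylinderMass_nonneg h0 h1 X ω))

/-- A reset bound bounds the probability of `B`. -/
lemma ResetBound.sum_le {s : ℕ} (h : ResetBound p B x y s Ψ) (hs : 2 ≤ s)
    (hΨ : 0 ≤ Ψ) : ∑ ω with B ω, configWeight p ω ≤ Ψ := by
  by_cases hB : ∃ ω, B ω
  · obtain ⟨ω, hω⟩ := hB
    have := h ∅ {x, y} ω hω (by simp) (by simp) (by simp) (by simp) (Finset.card_le_two.trans hs)
    rwa [eventMass, cylinderMass, edgeCylinder_empty, sum_configWeight, one_mul] at this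
  · push Not at hB
    rw [Finset.filter_false_of_mem fun ω _ => hB ω, Finset.sum_empty]
    exact hΨ

end Potential

/-! ### Iterating the phases -/

section Iteration

variable {V : Type*} [DecidableEq V] [Fintype V] {p η κ μ Ψ : ℝ} {l : ℕ}
  {B : (Sym2 V → Bool) → Prop} [DecidablePred B] {x y : V}

/-- One phase, with the parameters expressed in terms of the codegree bound `l`. -/
lemma ResetBound.step {t : ℕ} (h0 : 0 ≤ p) (h1 : p ≤ 1) (hκ : 0 ≤ κ) (hκ1 : κ ≤ 1)
    (hη : 0 ≤ η) (hη1 : η ≤ 1) (hΨ : 0 ≤ Ψ) (hl : 2 ≤ l) (hlt : l ≤ t) (hxy : x ≠ y)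
    (hB : ∀ ω, B ω → IsTypical p μ l ω)
    (hclosed : ∀ ω, B ω → ∀ (S : Finset V) (A : Finset (V × V)), Exploration ω S S A t →
      (x, y) ∈ A → t ^ 3 * l ^ 5 < S.card)
    (hreset : ResetBound p B x y (t ^ 9 * l ^ 15) Ψ)
    (hlη : 7 ≤ η * l) (hlκ : 3 ≤ κ * l ^ 2)
    (hdrift : ∀ c : ℕ, (1 + η) * (2 * (μ ^ 2 + 2 * c * μ) + κ * μ) ≤ 2 * max 2 c) :
    ResetBound p B x y t (Real.exp (-l) + t ^ 12 * l ^ 20 * p * Ψ) := by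
  have hl0 : (2 : ℝ) ≤ l := by exact_mod_cast hl
  have ht0 : (l : ℝ) ≤ t := by exact_mod_cast hlt
  have htpos : (0 : ℝ) < t := by linarith
  have hlpos : (0 : ℝ) < l := by linarith
  set α : ℝ := 1 / (t * l ^ 3) with hα
  have hαpos : 0 < α := by positivity
  set cap : ℕ := t ^ 3 * l ^ 5 with hcap
  have hcapN : cap + cap ^ 2 * l ≤ cap ^ 3 := by
    have h2 : 1 + l ≤ cap := by
      have h3 : 1 ≤ t ^ 3 := Nat.one_le_pow _ _ (by omega)
      have h4 : l * 2 ≤ l ^ 5 := by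
        calc l * 2 ≤ l * l ^ 4 := Nat.mul_le_mul_left _ (hl.trans (Nat.le_self_pow (by norm_num) l))
          _ = l ^ 5 := by ring
      nlinarith [Nat.mul_le_mul h3 h4]
    nlinarith [Nat.mul_le_mul_left (cap ^ 2) h2, Nat.le_self_pow (two_ne_zero) cap]
  have hcap9 : cap ^ 3 = t ^ 9 * l ^ 15 := by rw [hcap]; ring
  have key := ResetBound.improve (α := α) (β := κ * α) (cap := cap) h0 h1 hαpos.le
    (by positivity) hη hη1 hΨ (hl.trans hlt) hlt hxy hB hclosed
    (hreset.mono (hcapN.trans hcap9.le)) ?_ ?_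
  · refine key.weaken h0 h1 (add_le_add (Real.exp_le_exp.2 ?_) ?_)
    · have e : α * (t : ℝ) ^ 3 + κ * α * (t - cap) = t ^ 2 / l ^ 3 + κ / l ^ 3 - κ * l ^ 2 * t ^ 2 := by
        rw [hα, hcap]
        push_cast
        field_simp
        ring
      have hl3 : (1 : ℝ) ≤ l ^ 3 := one_le_pow₀ (by linarith)
      have e1 : (t : ℝ) ^ 2 / l ^ 3 ≤ t ^ 2 := div_le_self (by positivity) hl3
      have e2 : κ / (l : ℝ) ^ 3 ≤ 1 := (div_le_self hκ hl3).trans hκ1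
      have e3 := mul_le_mul_of_nonneg_right hlκ (by positivity : (0 : ℝ) ≤ t ^ 2)
      rw [e]
      nlinarith
    · have h2 : ((cap + cap ^ 2 * l : ℕ) : ℝ) ≤ (cap : ℝ) ^ 3 := by exact_mod_cast hcapN
      calc (cap : ℝ) * ((cap + cap ^ 2 * l : ℕ) * p * Ψ) ≤ cap * (cap ^ 3 * p * Ψ) := by gcongr
        _ = _ := by rw [hcap]; push_cast; ring
  · have e : (t : ℝ) * (6 * α * l ^ 2 + κ * α * l) = (6 * l + κ) / l ^ 2 := by
      rw [hα]
      field_simp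
    rw [e, div_le_iff₀ (by positivity)]
    nlinarith
  · intro c
    have := mul_le_mul_of_nonneg_left (hdrift c) hαpos.le
    linarith

/-- The exponents of `l` in the sizes of the successive restarts. -/
def growth : ℕ → ℕ
  | 0 => 1
  | i + 1 => 9 * growth i + 15

lemma growth_mono : Monotone growth :=
  monotone_nat_of_le_succ fun i => by rw [growth]; omega

lemma one_le_growth (i : ℕ) : 1 ≤ growth i := growth_mono (Nat.zero_le i)

/-- The bound from `j` successive phases, the last of which starts with sets of size
`l ^ growth i`. -/
theorem resetBound_iterate (h0 : 0 ≤ p) (h1 : p ≤ 1) (hκ : 0 ≤ κ) (hκ1 : κ ≤ 1)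
    (hη : 0 ≤ η) (hη1 : η ≤ 1) (hl : 2 ≤ l) (hxy : x ≠ y)
    (hB : ∀ ω, B ω → IsTypical p μ l ω) {m : ℕ}
    (hclosed : ∀ ω, B ω → ∀ (S : Finset V) (A : Finset (V × V)) (r : ℕ), Exploration ω S S A r →
      (x, y) ∈ A → l ^ (3 * growth m + 5) < S.card)
    (hlη : 7 ≤ η * l) (hlκ : 3 ≤ κ * l ^ 2)
    (hdrift : ∀ c : ℕ, (1 + η) * (2 * (μ ^ 2 + 2 * c * μ) + κ * μ) ≤ 2 * max 2 c) {δ : ℝ}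
    (hδ : (l : ℝ) ^ (4 * (3 * growth m + 5)) * p ≤ δ) (hδ1 : δ ≤ 1) (j : ℕ) :
    ∀ i, i + j ≤ m + 1 → ResetBound p B x y (l ^ growth i) (j * Real.exp (-l) + δ ^ j) := by
  have hl1 : (1 : ℝ) ≤ l := by exact_mod_cast (by omega : 1 ≤ l)
  have hδ0 : 0 ≤ δ := le_trans (by positivity) hδ
  induction j with
  | zero => intro i _; simpa using resetBound_one h0 h1 _
  | succ j ih =>
    intro i hi
    have hgi : growth i ≤ growth m := growth_mono (by omega)
    have e1 : (l ^ growth i) ^ 9 * l ^ 15 = l ^ growth (i + 1) := by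
      rw [← pow_mul, ← pow_add, growth]
      congr 1
      ring
    have e2 : (l ^ growth i) ^ 3 * l ^ 5 ≤ l ^ (3 * growth m + 5) := by
      rw [← pow_mul, ← pow_add]
      exact Nat.pow_le_pow_right (by omega) (by omega)
    have hpos : 0 ≤ (j : ℝ) * Real.exp (-l) + δ ^ j := by positivity
    refine (ResetBound.step (t := l ^ growth i) h0 h1 hκ hκ1 hη hη1 hpos hl
      (Nat.le_self_pow (by have := one_le_growth i; omega) l) hxy hB
      (fun ω hω S A hA hmem => e2.trans_lt (hclosed ω hω S A _ hA hmem))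
      (e1 ▸ ih (i + 1) (by omega)) hlη hlκ hdrift).weaken h0 h1 ?_
    have e3 : ((l ^ growth i : ℕ) : ℝ) ^ 12 * l ^ 20 * p ≤ δ := by
      refine le_trans (mul_le_mul_of_nonneg_right ?_ h0) hδ
      push_cast
      rw [← pow_mul, ← pow_add]
      exact pow_le_pow_right₀ hl1 (by omega)
    calc _ ≤ Real.exp (-l) + δ * (j * Real.exp (-l) + δ ^ j) := by gcongr
      _ = Real.exp (-l) + δ * (j * Real.exp (-l)) + δ ^ (j + 1) := by ring
      _ ≤ Real.exp (-l) + 1 * (j * Real.exp (-l)) + δ ^ (j + 1) := by gcongr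
      _ = _ := by push_cast; ring

end Iteration

/-! ### Typical configurations -/

section Typical

variable {V : Type*} [DecidableEq V] [Fintype V] {p q μ : ℝ} {l : ℕ}

open Classical in
/-- The probability of an event in the random graph. -/
def prob (p : ℝ) (P : (Sym2 V → Bool) → Prop) : ℝ :=
  ∑ ω with P ω, configWeight p ω

lemma prob_mono (h0 : 0 ≤ p) (h1 : p ≤ 1) {P Q : (Sym2 V → Bool) → Prop} (h : ∀ ω, P ω → Q ω) :
    prob p P ≤ prob p Q := by
  classical
  exact Finset.sum_le_sum_of_subset_of_nonneg
    (Finset.monotone_filter_right _ fun ω _ => h ω) fun _ _ _ => configWeight_nonneg h0 h1 _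

lemma prob_or_le (h0 : 0 ≤ p) (h1 : p ≤ 1) (P Q : (Sym2 V → Bool) → Prop) :
    prob p (fun ω => P ω ∨ Q ω) ≤ prob p P + prob p Q := by
  classical
  simp only [prob, Finset.sum_filter, ← Finset.sum_add_distrib]
  refine Finset.sum_le_sum fun ω _ => ?_
  have := configWeight_nonneg h0 h1 ω
  by_cases hP : P ω <;> by_cases hQ : Q ω <;> simp [hP, hQ, this]

lemma prob_exists_le {ι : Type*} (h0 : 0 ≤ p) (h1 : p ≤ 1) (s : Finset ι)
    (P : ι → (Sym2 V → Bool) → Prop) {c : ℝ} (hc : ∀ i ∈ s, prob p (P i) ≤ c) :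
    prob p (fun ω => ∃ i ∈ s, P i ω) ≤ s.card * c := by
  classical
  rw [← nsmul_eq_mul]
  refine le_trans ?_ (Finset.sum_le_card_nsmul s (fun i => prob p (P i)) c hc)
  simp only [prob, Finset.sum_filter]
  rw [Finset.sum_comm]
  refine Finset.sum_le_sum fun ω _ => ?_
  have hw := configWeight_nonneg h0 h1 ω
  have hnn : ∀ i ∈ s, 0 ≤ if P i ω then configWeight p ω else 0 := fun i _ => by
    split_ifs <;> simp [hw]
  split_ifs with h
  · obtain ⟨i, hi, hPi⟩ := h
    refine le_trans (le_of_eq ?_) (Finset.single_le_sum hnn hi)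
    rw [if_pos hPi]
  · exact Finset.sum_nonneg hnn

lemma prob_forall_mem (p : ℝ) (T : Finset (Sym2 V)) :
    prob p (fun ω => ∀ e ∈ T, ω e = true) = p ^ T.card := by
  classical
  have := sum_edgeCylinder_inter p ∅ (fun _ => true) T (by simp)
  rw [cylinderMass, edgeCylinder_empty, sum_configWeight, mul_one] at this
  rw [← this, prob]
  congr!

/-- Markov's inequality for the factorial moments of the size of a random set. -/
lemma prob_mul_le (h0 : 0 ≤ p) (h1 : p ≤ 1) (N : (Sym2 V → Bool) → Finset V)
    (P : (Sym2 V → Bool) → Prop) {c M : ℝ}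
    (hc : ∀ T : Finset V, T.card = l → prob p (fun ω => T ⊆ N ω) ≤ c)
    (hM : ∀ ω, P ω → M ≤ (N ω).card.descFactorial l) (hM0 : 0 ≤ c) :
    prob p P * M ≤ (Fintype.card V : ℝ) ^ l * c := by
  classical
  have hcount : ∀ ω, (((N ω).card.choose l : ℕ) : ℝ)
      = ∑ T ∈ Finset.powersetCard l Finset.univ, if T ⊆ N ω then 1 else 0 := by
    intro ω
    rw [Finset.sum_boole, ← Finset.card_powersetCard]
    congr 2
    ext T
    simp only [Finset.mem_powersetCard, Finset.mem_filter, Finset.subset_univ, true_and]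
    tauto
  calc prob p P * M = ∑ ω with P ω, configWeight p ω * M := by rw [prob, Finset.sum_mul]
    _ ≤ ∑ ω with P ω, configWeight p ω * (N ω).card.descFactorial l :=
        Finset.sum_le_sum fun ω hω => mul_le_mul_of_nonneg_left (hM ω (Finset.mem_filter.1 hω).2)
          (configWeight_nonneg h0 h1 ω)
    _ ≤ ∑ ω, configWeight p ω * (N ω).card.descFactorial l :=
        Finset.sum_le_sum_of_subset_of_nonneg (Finset.filter_subset _ _) fun ω _ _ =>
          mul_nonneg (configWeight_nonneg h0 h1 ω) (Nat.cast_nonneg _)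
    _ = l.factorial * ∑ T ∈ Finset.powersetCard l (Finset.univ : Finset V),
          prob p (fun ω => T ⊆ N ω) := by
        simp only [prob, Finset.sum_filter]
        rw [Finset.sum_comm, Finset.mul_sum]
        refine Finset.sum_congr rfl fun ω _ => ?_
        rw [Nat.descFactorial_eq_factorial_mul_choose, Nat.cast_mul, hcount, ← mul_assoc,
          mul_comm (configWeight p ω), mul_assoc, Finset.mul_sum]
        simp only [mul_ite, mul_one, mul_zero]
    _ ≤ l.factorial * ((Finset.powersetCard l (Finset.univ : Finset V)).card * c) := by
        refine mul_le_mul_of_nonneg_left ?_ (Nat.cast_nonneg _)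
        rw [← nsmul_eq_mul]
        exact Finset.sum_le_card_nsmul _ _ _ fun T hT => hc T (Finset.mem_powersetCard.1 hT).2
    _ = ((Fintype.card V).descFactorial l : ℕ) * c := by
        rw [Finset.card_powersetCard, Finset.card_univ, Nat.descFactorial_eq_factorial_mul_choose,
          Nat.cast_mul, mul_assoc]
    _ ≤ (Fintype.card V : ℝ) ^ l * c := by
        refine mul_le_mul_of_nonneg_right ?_ hM0
        exact_mod_cast Nat.descFactorial_le_pow _ _

lemma prob_eq_zero {P : (Sym2 V → Bool) → Prop} (h : ∀ ω, ¬ P ω) : prob p P = 0 := by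
  classical
  rw [prob, Finset.filter_false_of_mem fun ω _ => h ω, Finset.sum_empty]

lemma prob_subset_nbrsIn_le (h0 : 0 ≤ p) (h1 : p ≤ 1) (v : V) (T : Finset V) :
    prob p (fun ω => T ⊆ nbrsIn ω Finset.univ v) ≤ p ^ T.card := by
  by_cases hv : v ∈ T
  · rw [prob_eq_zero fun ω h => (mem_nbrsIn.1 (h hv)).2.1 rfl]
    positivity
  · have : (T.image fun w => s(v, w)).card = T.card :=
      Finset.card_image_of_injective _ fun a b hab => Sym2.congr_right.1 hab
    rw [← this, ← prob_forall_mem]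
    refine prob_mono h0 h1 fun ω h e he => ?_
    obtain ⟨w, hw, rfl⟩ := Finset.mem_image.1 he
    exact (mem_nbrsIn.1 (h hw)).2.2

lemma prob_subset_commonNbrs_le (h0 : 0 ≤ p) (h1 : p ≤ 1) {u v : V} (huv : u ≠ v)
    (T : Finset V) :
    prob p (fun ω => T ⊆ commonNbrs ω Finset.univ u v) ≤ p ^ (2 * T.card) := by
  by_cases hu : u ∈ T
  · rw [prob_eq_zero fun ω h => (mem_commonNbrs.1 (h hu)).2.1.1 rfl]
    positivity
  · have hdisj : Disjoint (T.image fun w => s(u, w)) (T.image fun w => s(v, w)) := by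
      rw [Finset.disjoint_left]
      intro e he he'
      obtain ⟨w, hw, rfl⟩ := Finset.mem_image.1 he
      obtain ⟨w', hw', h⟩ := Finset.mem_image.1 he'
      rcases Sym2.eq_iff.1 h with ⟨h2, -⟩ | ⟨-, h2⟩
      · exact huv h2.symm
      · exact hu (h2 ▸ hw')
    have hcard : ((T.image fun w => s(u, w)) ∪ (T.image fun w => s(v, w))).card = 2 * T.card := by
      rw [Finset.card_union_of_disjoint hdisj,
        Finset.card_image_of_injective _ fun a b hab => Sym2.congr_right.1 hab,
        Finset.card_image_of_injective _ fun a b hab => Sym2.congr_right.1 hab, two_mul]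
    rw [← hcard, ← prob_forall_mem]
    refine prob_mono h0 h1 fun ω h e he => ?_
    rcases Finset.mem_union.1 he with he | he <;> obtain ⟨w, hw, rfl⟩ := Finset.mem_image.1 he
    · exact (mem_commonNbrs.1 (h hw)).2.1.2
    · exact (mem_commonNbrs.1 (h hw)).2.2.2

lemma prob_codegree_le (h0 : 0 ≤ p) (h1 : p ≤ 1) (hq : Fintype.card V * p ^ 2 ≤ q)
    {u v : V} (huv : u ≠ v) :
    prob p (fun ω => l < (commonNbrs ω Finset.univ u v).card) ≤ q ^ l := by
  have := prob_mul_le (l := l) (c := p ^ (2 * l)) (M := 1) h0 h1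
    (fun ω => commonNbrs ω Finset.univ u v)
    (fun ω => l < (commonNbrs ω Finset.univ u v).card)
    (fun T hT => hT ▸ prob_subset_commonNbrs_le h0 h1 huv T)
    (fun ω hω => by
      have := Nat.descFactorial_pos.2 (Nat.le_of_lt hω)
      exact_mod_cast this) (by positivity)
  rw [mul_one, pow_mul, ← mul_pow] at this
  exact this.trans (pow_le_pow_left₀ (by positivity) hq l)

lemma prob_degree_le (h0 : 0 ≤ p) (h1 : p ≤ 1) (hμ : 0 ≤ μ) (hlp : l * p < μ)
    (hq0 : 0 ≤ q) (hq : Fintype.card V * p ^ 2 ≤ q * (μ - l * p)) (v : V) :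
    prob p (fun ω => ¬ ((nbrsIn ω Finset.univ v).card : ℝ) * p ≤ μ) ≤ q ^ l := by
  rcases h0.eq_or_lt with rfl | hp
  · rw [prob_eq_zero fun ω h => h (by simpa using hμ)]
    positivity
  have hD : 0 < μ / p - l := by rwa [sub_pos, lt_div_iff₀ hp]
  have key := prob_mul_le (l := l) (c := p ^ l) (M := (μ / p - l) ^ l) h0 h1
    (fun ω => nbrsIn ω Finset.univ v)
    (fun ω => ¬ ((nbrsIn ω Finset.univ v).card : ℝ) * p ≤ μ)
    (fun T hT => hT ▸ prob_subset_nbrsIn_le h0 h1 v T)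
    (fun ω hω => by
      have h2 : μ / p < (nbrsIn ω Finset.univ v).card := by
        rw [div_lt_iff₀ hp]
        exact not_le.1 hω
      have h3 : l ≤ (nbrsIn ω Finset.univ v).card + 1 := by
        have : (l : ℝ) ≤ ((nbrsIn ω Finset.univ v).card : ℝ) + 1 := by linarith
        exact_mod_cast this
      refine le_trans ?_ (by exact_mod_cast Nat.pow_sub_le_descFactorial _ _ :
        (((nbrsIn ω Finset.univ v).card + 1 - l : ℕ) : ℝ) ^ l ≤ _)
      refine pow_le_pow_left₀ hD.le ?_ l
      rw [Nat.cast_sub h3]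
      push_cast
      linarith) (by positivity)
  rw [← mul_pow] at key
  refine le_of_mul_le_mul_right (key.trans ?_) (pow_pos hD l)
  rw [← mul_pow]
  refine pow_le_pow_left₀ (by positivity) ?_ l
  refine le_of_mul_le_mul_right ?_ hp
  calc Fintype.card V * p * p = Fintype.card V * p ^ 2 := by ring
    _ ≤ q * (μ - l * p) := hq
    _ = q * (μ / p - l) * p := by field_simp

lemma prob_not_isTypical_le (h0 : 0 ≤ p) (h1 : p ≤ 1) (hμ1 : μ ≤ 1) (hlp : l * p < μ)
    (hq0 : 0 ≤ q) (hq : Fintype.card V * p ^ 2 ≤ q * (μ - l * p)) :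
    prob p (fun ω : Sym2 V → Bool => ¬ IsTypical p μ l ω)
      ≤ (Fintype.card V ^ 2 + Fintype.card V : ℝ) * q ^ l := by
  have hlp0 : 0 ≤ l * p := by positivity
  have hq' : Fintype.card V * p ^ 2 ≤ q :=
    hq.trans (mul_le_of_le_one_right hq0 (by linarith))
  have hsub : ∀ ω : Sym2 V → Bool, ¬ IsTypical p μ l ω →
      (∃ e ∈ (Finset.univ : Finset V).offDiag, l < (commonNbrs ω Finset.univ e.1 e.2).card) ∨
      ∃ v ∈ (Finset.univ : Finset V), ¬ ((nbrsIn ω Finset.univ v).card : ℝ) * p ≤ μ := by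
    intro ω hω
    by_contra! h
    exact hω ⟨fun u v huv => h.1 (u, v) (by simpa using huv), fun v => h.2 v (Finset.mem_univ v)⟩
  refine (prob_mono h0 h1 hsub).trans ((prob_or_le h0 h1 _ _).trans ?_)
  rw [add_mul]
  refine add_le_add ((prob_exists_le h0 h1 _ _ fun e he =>
    prob_codegree_le h0 h1 hq' (Finset.mem_offDiag.1 he).2.2).trans ?_)
    (prob_exists_le h0 h1 _ _ fun v _ => prob_degree_le h0 h1 (hlp0.trans hlp.le) hlp hq0 hq v)
  refine mul_le_mul_of_nonneg_right ?_ (by positivity)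
  rw [Finset.offDiag_card, sq]
  exact_mod_cast Nat.sub_le _ _

end Typical

/-! ### Components of the auxiliary graph -/

section Components

variable {n : ℕ} {p q μ κ η δ : ℝ} {l : ℕ}

lemma suppOf_boxComponent_subset {ω : Sym2 (Fin n) → Bool} {S : Finset (Fin n)}
    {A : Finset (Fin n × Fin n)} {r : ℕ} (h : Exploration ω S S A r) {x y : Fin n}
    (hxy : (x, y) ∈ A) : suppOf (boxComponent (graphOf ω) s(x, y)) ⊆ (S : Set (Fin n)) := by
  have hmem : ∀ {e f}, (boxGraph (graphOf ω)).Adj e f → (∃ u v, e = s(u, v) ∧ (u, v) ∈ A) →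
      ∃ u v, f = s(u, v) ∧ (u, v) ∈ A := by
    rintro e f hef ⟨u, v, rfl, huv⟩
    obtain ⟨a, b, c, d, hac, rfl, -, hbd, hab, hbc, hcd, hda⟩ : boxAdj (graphOf ω) s(u, v) f := by
      rcases ((SimpleGraph.fromRel_adj _ _ _).1 hef).2 with h1 | ⟨a, b, c, d, h1, h2, h3⟩
      · exact h1
      · exact ⟨b, c, d, a, h2, h1.trans Sym2.eq_swap, h3.2.1, h3.1.symm, h3.2.2.2.1, h3.2.2.2.2.1,
          h3.2.2.2.2.2, h3.2.2.1⟩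
    rw [graphOf_adj] at hab hbc hcd hda
    have hacA : (a, c) ∈ A := by
      rcases Sym2.eq_iff.1 hac with ⟨rfl, rfl⟩ | ⟨rfl, rfl⟩
      · exact huv
      · exact h.symm huv
    exact ⟨b, d, rfl, h.closed hacA hbd hab hbc.symm hda.symm hcd
      (Or.inl ⟨h.fst_mem hacA, h.snd_mem hacA⟩)⟩
  have hreach : ∀ f, (boxGraph (graphOf ω)).Reachable s(x, y) f →
      ∃ u v, f = s(u, v) ∧ (u, v) ∈ A := by
    intro f hf
    rw [SimpleGraph.reachable_iff_reflTransGen] at hf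
    induction hf with
    | refl => exact ⟨x, y, rfl, hxy⟩
    | tail _ hadj ih => exact hmem hadj ih
  rintro w ⟨f, hf, hwf⟩
  obtain ⟨u, v, rfl, huv⟩ := hreach f hf
  rcases Sym2.mem_iff.1 hwf with rfl | rfl
  · exact h.fst_mem huv
  · exact h.snd_mem huv

/-- A bound for the probability that some component has a large support. -/
theorem prob_large_component_le (m : ℕ) (h0 : 0 ≤ p) (h1 : p ≤ 1) (hκ : 0 ≤ κ) (hκ1 : κ ≤ 1)
    (hη : 0 ≤ η) (hη1 : η ≤ 1) (hl : 2 ≤ l) (hlη : 7 ≤ η * l) (hlκ : 3 ≤ κ * l ^ 2)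
    (hdrift : ∀ c : ℕ, (1 + η) * (2 * (μ ^ 2 + 2 * c * μ) + κ * μ) ≤ 2 * max 2 c)
    (hμ1 : μ ≤ 1) (hlp : l * p < μ) (hq0 : 0 ≤ q) (hq : n * p ^ 2 ≤ q * (μ - l * p))
    (hδ : (l : ℝ) ^ (4 * (3 * growth m + 5)) * p ≤ δ) (hδ1 : δ ≤ 1) :
    prob p (fun ω => ¬ ∀ e : Sym2 (Fin n), ¬ e.IsDiag →
      (suppOf (boxComponent (graphOf ω) e)).ncard ≤ l ^ (3 * growth m + 5))
      ≤ (n ^ 2 + n : ℝ) * q ^ l + n ^ 2 * ((m + 1 : ℕ) * Real.exp (-l) + δ ^ (m + 1)) := by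
  classical
  have hδ0 : 0 ≤ δ := le_trans (by positivity) hδ
  let large (e : Fin n × Fin n) (ω : Sym2 (Fin n) → Bool) : Prop :=
    l ^ (3 * growth m + 5) < (suppOf (boxComponent (graphOf ω) s(e.1, e.2))).ncard
  have hsub : ∀ ω : Sym2 (Fin n) → Bool, (¬ ∀ e : Sym2 (Fin n), ¬ e.IsDiag →
      (suppOf (boxComponent (graphOf ω) e)).ncard ≤ l ^ (3 * growth m + 5)) →
      ¬ IsTypical p μ l ω ∨ ∃ e ∈ (Finset.univ : Finset (Fin n)).offDiag,
        IsTypical p μ l ω ∧ large e ω := by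
    intro ω hω
    by_cases ht : IsTypical p μ l ω
    · push Not at hω
      obtain ⟨e, he, hlarge⟩ := hω
      induction e with
      | _ x y => exact Or.inr ⟨(x, y), by simpa using he, ht, hlarge⟩
    · exact Or.inl ht
  refine (prob_mono h0 h1 hsub).trans ((prob_or_le h0 h1 _ _).trans (add_le_add ?_ ?_))
  · simpa using prob_not_isTypical_le (V := Fin n) h0 h1 hμ1 hlp hq0 (by simpa using hq)
  · have hpos : 0 ≤ ((m + 1 : ℕ) : ℝ) * Real.exp (-l) + δ ^ (m + 1) := by positivity
    refine (prob_exists_le (c := ((m + 1 : ℕ) : ℝ) * Real.exp (-l) + δ ^ (m + 1)) h0 h1 _ _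
      fun e he => ?_).trans (mul_le_mul_of_nonneg_right ?_ hpos)
    · have := resetBound_iterate (B := fun ω => IsTypical p μ l ω ∧ large e ω) (x := e.1) (y := e.2)
        (m := m) h0 h1 hκ hκ1 hη hη1 hl (Finset.mem_offDiag.1 he).2.2 (fun ω hω => hω.1)
        (fun ω hω S A r hA hmem => hω.2.trans_le
          ((Set.ncard_le_ncard (suppOf_boxComponent_subset hA hmem) S.finite_toSet).trans
            (Set.ncard_coe_finset S).le)) hlη hlκ hdrift hδ hδ1 (m + 1) 0 (by omega)
      refine le_trans (le_of_eq ?_) (this.sum_le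
        (hl.trans (Nat.le_self_pow (by have := one_le_growth 0; omega) l)) hpos)
      rw [prob]
      congr!
    · rw [Finset.offDiag_card, sq]
      simp only [Finset.card_univ, Fintype.card_fin]
      exact_mod_cast Nat.sub_le _ _

end Components

/-! ### The random graph measure -/

section Measure

variable {n : ℕ} {p : ℝ}

instance (p : ℝ) : IsFiniteMeasure (bernoulliBool p) :=
  ⟨by simp [bernoulliBool, ENNReal.add_lt_top]⟩

lemma bernoulliBool_singleton (p : ℝ) (b : Bool) :
    bernoulliBool p {b} = ENNReal.ofReal (bitWeight p b) := by
  cases b <;> simp [bernoulliBool, bitWeight]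

lemma erMeasure_eq_prob (h0 : 0 ≤ p) (h1 : p ≤ 1) (P : (Sym2 (Fin n) → Bool) → Prop) :
    erMeasure n p {ω | P ω} = ENNReal.ofReal (prob p P) := by
  classical
  have hset : {ω | P ω} = ((Finset.univ.filter P : Finset (Sym2 (Fin n) → Bool)) :
      Set (Sym2 (Fin n) → Bool)) := by
    ext ω
    simp
  rw [hset, ← sum_measure_singleton, prob, ENNReal.ofReal_sum_of_nonneg
    fun _ _ => configWeight_nonneg h0 h1 _]
  refine Finset.sum_congr (by congr!) fun ω _ => ?_
  rw [erMeasure, Measure.pi_singleton, configWeight, ENNReal.ofReal_prod_of_nonneg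
    fun _ _ => bitWeight_nonneg h0 h1 _]
  exact Finset.prod_congr rfl fun e _ => bernoulliBool_singleton p _

lemma prob_le_one {V : Type*} [DecidableEq V] [Fintype V] (h0 : 0 ≤ p) (h1 : p ≤ 1)
    (P : (Sym2 V → Bool) → Prop) : prob p P ≤ 1 := by
  classical
  rw [← sum_configWeight (E := Sym2 V) p]
  exact Finset.sum_le_sum_of_subset_of_nonneg (Finset.filter_subset _ _)
    fun _ _ _ => configWeight_nonneg h0 h1 _

lemma one_le_prob_add_prob_not {V : Type*} [DecidableEq V] [Fintype V]
    (P : (Sym2 V → Bool) → Prop) : 1 ≤ prob p P + prob p (fun ω => ¬ P ω) := by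
  classical
  rw [← sum_configWeight (E := Sym2 V) p, ← Finset.sum_filter_add_sum_filter_not _ P]
  refine le_of_eq ?_
  simp only [prob]

end Measure

/-! ### Asymptotics -/

section Asymptotics

/-- In the subcritical range, the drift of the potential is negative for suitable parameters. -/
lemma exists_drift_parameters {lam : ℝ} (h0 : 0 ≤ lam) (h : lam < lambdaC) :
    ∃ μ η κ : ℝ, lam ^ 2 < μ ∧ μ ≤ 1 ∧ 0 < η ∧ η ≤ 1 ∧ 0 < κ ∧ κ ≤ 1 ∧
      ∀ c : ℕ, (1 + η) * (2 * (μ ^ 2 + 2 * c * μ) + κ * μ) ≤ 2 * max 2 c := by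
  have h6 : Real.sqrt 6 ^ 2 = 6 := Real.sq_sqrt (by norm_num)
  have h6' : 2 < Real.sqrt 6 := Real.lt_sqrt_of_sq_lt (by norm_num)
  have h6'' : Real.sqrt 6 < 5 / 2 := (Real.sqrt_lt' (by norm_num)).2 (by norm_num)
  have hlam : lam ^ 2 < Real.sqrt 6 - 2 := by
    have : lambdaC ^ 2 = Real.sqrt 6 - 2 := Real.sq_sqrt (by linarith)
    rw [← this]
    exact pow_lt_pow_left₀ h h0 two_ne_zero
  obtain ⟨μ, hμ1, hμ2⟩ := exists_between hlam
  have hμ0 : 0 < μ := (sq_nonneg lam).trans_lt hμ1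
  set d : ℝ := (4 - 2 * μ ^ 2 - 8 * μ) / 5 with hd
  have hd0 : 0 < d := by
    have : (μ + 2) ^ 2 < 6 := by
      rw [← h6]
      exact pow_lt_pow_left₀ (by linarith) (by linarith) two_ne_zero
    rw [hd]
    linarith
  have hd1 : d ≤ 1 := by
    rw [hd]
    nlinarith
  refine ⟨μ, d, d, hμ1, by linarith, hd0, hd1, hd0, hd1, fun c => ?_⟩
  have hbase : (1 + d) * (2 * μ ^ 2 + 8 * μ + d * μ) ≤ 4 := by
    have e : 2 * μ ^ 2 + 8 * μ = 4 - 5 * d := by rw [hd]; ring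
    rw [e]
    nlinarith [mul_pos hd0 hμ0]
  have hM2 : (2 : ℝ) ≤ max 2 (c : ℝ) := le_max_left _ _
  have hMc : (c : ℝ) ≤ max 2 (c : ℝ) := le_max_right _ _
  set M : ℝ := max 2 (c : ℝ)
  calc (1 + d) * (2 * (μ ^ 2 + 2 * c * μ) + d * μ)
      ≤ (1 + d) * (M / 2 * (2 * μ ^ 2) + 4 * M * μ + M / 2 * (d * μ)) := by
        refine mul_le_mul_of_nonneg_left ?_ (by linarith)
        have hM2' : 1 ≤ M / 2 := by linarith
        have t1 : 2 * μ ^ 2 ≤ M / 2 * (2 * μ ^ 2) := le_mul_of_one_le_left (by positivity) hM2'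
        have t2 : d * μ ≤ M / 2 * (d * μ) := le_mul_of_one_le_left (by positivity) hM2'
        have t3 : c * μ ≤ M * μ := mul_le_mul_of_nonneg_right hMc hμ0.le
        linarith
    _ = M / 2 * ((1 + d) * (2 * μ ^ 2 + 8 * μ + d * μ)) := by ring
    _ ≤ M / 2 * 4 := by gcongr
    _ = 2 * max 2 c := by rw [Nat.cast_max]; push_cast; ring

lemma tendsto_log_pow_div_sqrt (B : ℕ) :
    Tendsto (fun n : ℕ => Real.log n ^ B / Real.sqrt n) atTop (nhds 0) := by
  have h := (isLittleO_log_rpow_rpow_atTop (B : ℝ)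
    (by norm_num : (0 : ℝ) < 1 / 2)).tendsto_div_nhds_zero
  refine (h.comp tendsto_natCast_atTop_atTop).congr fun n => ?_
  simp only [Function.comp_apply, Real.rpow_natCast, Real.sqrt_eq_rpow]

variable {K : ℝ}

lemma ceil_mul_log_le {n : ℕ} (hK : 0 ≤ K) (hn : 1 ≤ Real.log n) :
    ((⌈K * Real.log n⌉₊ : ℕ) : ℝ) ≤ (K + 1) * Real.log n := by
  have := (Nat.ceil_lt_add_one (mul_nonneg hK (by linarith : 0 ≤ Real.log n))).le
  linarith

lemma tendsto_log_natCast_atTop : Tendsto (fun n : ℕ => Real.log n) atTop atTop :=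
  Real.tendsto_log_atTop.comp tendsto_natCast_atTop_atTop

lemma tendsto_ceil_mul_log_pow_div_sqrt (hK : 0 ≤ K) (B : ℕ) :
    Tendsto (fun n : ℕ => ((⌈K * Real.log n⌉₊ : ℕ) : ℝ) ^ B / Real.sqrt n) atTop (nhds 0) := by
  have h := (tendsto_log_pow_div_sqrt B).const_mul ((K + 1) ^ B)
  rw [mul_zero] at h
  refine squeeze_zero' (Eventually.of_forall fun n => by positivity) ?_ h
  filter_upwards [tendsto_log_natCast_atTop.eventually_ge_atTop 1] with n hn
  rw [← mul_div_assoc, ← mul_pow]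
  have := ceil_mul_log_le hK hn
  gcongr

lemma pow_ceil_mul_log_le {q : ℝ} {n : ℕ} (hq0 : 0 < q) (hq1 : q ≤ 1) (hn : 0 < n)
    (hK : 3 ≤ K * -Real.log q) : q ^ ⌈K * Real.log n⌉₊ ≤ 1 / (n : ℝ) ^ 3 := by
  have hn' : (0 : ℝ) < n := by exact_mod_cast hn
  have hlogn : 0 ≤ Real.log n := Real.log_natCast_nonneg n
  rw [← Real.log_le_log_iff (by positivity) (by positivity), Real.log_pow, Real.log_div one_ne_zero
    (by positivity), Real.log_one, Real.log_pow]
  have h1 : K * Real.log n ≤ ((⌈K * Real.log n⌉₊ : ℕ) : ℝ) := Nat.le_ceil _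
  have hneg : Real.log q ≤ 0 := Real.log_nonpos hq0.le hq1
  push_cast
  nlinarith

lemma failure_bound_le {n l b : ℕ} {q lam : ℝ} (hn : 1 ≤ n) (hq0 : 0 ≤ q)
    (hq : q ^ l ≤ 1 / (n : ℝ) ^ 3)
    (he : Real.exp (-(l : ℝ)) ≤ 1 / (n : ℝ) ^ 3) :
    (n ^ 2 + n : ℝ) * q ^ l + n ^ 2 * ((4 + 1 : ℕ) * Real.exp (-(l : ℝ))
        + (lam * ((l : ℝ) ^ (4 * b) / Real.sqrt n)) ^ (4 + 1))
      ≤ 2 * (n : ℝ)⁻¹ + 5 * (n : ℝ)⁻¹ + lam ^ 5 * ((l : ℝ) ^ (20 * b) / Real.sqrt n) := by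
  have hn1 : (1 : ℝ) ≤ n := by exact_mod_cast hn
  have hn0 : (0 : ℝ) < n := by linarith
  have hpow : (n : ℝ) ^ 2 * (lam * ((l : ℝ) ^ (4 * b) / Real.sqrt n)) ^ (4 + 1)
      = lam ^ 5 * ((l : ℝ) ^ (20 * b) / Real.sqrt n) := by
    have hsq : (n : ℝ) = Real.sqrt n ^ 2 := (Real.sq_sqrt hn0.le).symm
    have hsqrt : 0 < Real.sqrt n := Real.sqrt_pos.2 hn0
    set s := Real.sqrt n
    rw [hsq, show 20 * b = 4 * b * 5 by ring, pow_mul (l : ℝ) (4 * b) 5, mul_pow,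
      div_pow]
    field_simp
    ring
  have t1 : (n ^ 2 + n : ℝ) * q ^ l ≤ 2 * (n : ℝ)⁻¹ := by
    calc (n ^ 2 + n : ℝ) * q ^ l ≤ (2 * n ^ 2) * (1 / (n : ℝ) ^ 3) :=
          mul_le_mul (by nlinarith) hq (pow_nonneg hq0 l) (by positivity)
      _ = 2 * (n : ℝ)⁻¹ := by field_simp
  have t2 : (n : ℝ) ^ 2 * Real.exp (-(l : ℝ)) ≤ (n : ℝ)⁻¹ := by
    calc (n : ℝ) ^ 2 * Real.exp (-(l : ℝ)) ≤ n ^ 2 * (1 / (n : ℝ) ^ 3) := by gcongr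
      _ = (n : ℝ)⁻¹ := by field_simp
  rw [mul_add, hpow]
  push_cast
  linarith

end Asymptotics

/-- **Subcritical behaviour for `⊠(Γ)`.** If `λ < λ_c` is fixed and `p(n) ≤ λ n^{-1/2}`,
then a.a.s. every connected component of `⊠(Γ)` for `Γ ∈ G(n,p)` has support of size at
most `C (log n)^{2^31}`. -/
theorem subcritical_small_box_components
    (lam : ℝ) (hlam : lam < lambdaC)
    (p : ℕ → ℝ) (hp0 : ∀ n, 0 ≤ p n)
    (hp : ∀ n : ℕ, 1 ≤ n → p n ≤ lam / Real.sqrt n) :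
    ∃ C : ℝ, 0 < C ∧
      Tendsto
        (fun n : ℕ => erMeasure n (p n)
          {ω | ∀ e : Sym2 (Fin n), ¬ e.IsDiag →
            ((suppOf (boxComponent (graphOf ω) e)).ncard : ℝ)
              ≤ C * Real.log n ^ (2 ^ 31 : ℕ)})
        atTop (nhds 1) := by
  have hlam0 : 0 ≤ lam := by simpa using (hp0 1).trans (hp 1 le_rfl)
  obtain ⟨μ, η, κ, hμ, hμ1, hη, hη1, hκ, hκ1, hdrift⟩ := exists_drift_parameters hlam0 hlam
  have hμ0 : 0 < μ := (sq_nonneg lam).trans_lt hμ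
  set q : ℝ := (lam ^ 2 / μ + 1) / 2 with hq
  have hlamμ : lam ^ 2 / μ < 1 := (div_lt_one hμ0).2 hμ
  have hq0 : 0 < q := by positivity
  have hq1 : q < 1 := by rw [hq]; linarith
  have hqμ : q * μ = (lam ^ 2 + μ) / 2 := by rw [hq]; field_simp
  have hlogq : 0 < -Real.log q := neg_pos.2 (Real.log_neg hq0 hq1)
  set K : ℝ := max 3 (3 / -Real.log q) with hK
  have hK3 : 3 ≤ K := le_max_left _ _
  have hK0 : 0 ≤ K := by linarith
  have hKq : 3 ≤ K * -Real.log q := (div_le_iff₀ hlogq).1 (le_max_right _ _)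
  obtain ⟨b, hb⟩ : ∃ b, b = 3 * growth 4 + 5 := ⟨_, rfl⟩
  have hb31 : b ≤ 2 ^ 31 := by rw [hb]; norm_num [growth]
  set l : ℕ → ℕ := fun n => ⌈K * Real.log n⌉₊ with hl
  set δ : ℕ → ℝ := fun n => lam * ((l n : ℝ) ^ (4 * b) / Real.sqrt n) with hδ
  have hsmall : ∀ B, Tendsto (fun n : ℕ => (l n : ℝ) ^ B / Real.sqrt n) atTop (nhds 0) :=
    tendsto_ceil_mul_log_pow_div_sqrt hK0
  have hltop : Tendsto (fun n => (l n : ℝ)) atTop atTop := by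
    refine tendsto_atTop_mono (fun n => Nat.le_ceil _) ?_
    exact tendsto_log_natCast_atTop.const_mul_atTop (by linarith)
  have hδ0 : Tendsto δ atTop (nhds 0) := by simpa using (hsmall (4 * b)).const_mul lam
  have hlam0' : Tendsto (fun n => lam * ((l n : ℝ) ^ 1 / Real.sqrt n)) atTop (nhds 0) := by
    simpa using (hsmall 1).const_mul lam
  set err : ℕ → ℝ := fun n => 2 * (n : ℝ)⁻¹ + 5 * (n : ℝ)⁻¹
    + lam ^ 5 * ((l n : ℝ) ^ (20 * b) / Real.sqrt n) with herr
  have herr0 : Tendsto err atTop (nhds 0) := by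
    have h1 := tendsto_inv_atTop_nhds_zero_nat (𝕜 := ℝ)
    simpa using ((h1.const_mul 2).add (h1.const_mul 5)).add ((hsmall (20 * b)).const_mul (lam ^ 5))
  refine ⟨(K + 1) ^ b, by positivity, ?_⟩
  have hbounds : ∀ᶠ n : ℕ in atTop, p n ≤ 1 ∧ 1 - err n ≤ prob (p n) (fun ω =>
      ∀ e : Sym2 (Fin n), ¬ e.IsDiag → ((suppOf (boxComponent (graphOf ω) e)).ncard : ℝ)
        ≤ (K + 1) ^ b * Real.log n ^ (2 ^ 31 : ℕ)) := by
    filter_upwards [eventually_ge_atTop 1, tendsto_log_natCast_atTop.eventually_ge_atTop 1,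
      hltop.eventually_ge_atTop 2, hltop.eventually_ge_atTop (7 / η),
      hltop.eventually_ge_atTop (3 / κ), hδ0.eventually_le_const one_pos,
      hlam0'.eventually_le_const (by linarith : 0 < (μ - lam ^ 2) / 2)]
      with n hn hlogn hl2 hlη hlκ hδ1 hlp
    have hn1 : (1 : ℝ) ≤ n := by exact_mod_cast hn
    have hn0 : (0 : ℝ) < n := by linarith
    have hsq : Real.sqrt n ^ 2 = n := Real.sq_sqrt hn0.le
    have hsqrt : 1 ≤ Real.sqrt n := Real.one_le_sqrt.2 hn1
    have hsqrt0 : 0 < Real.sqrt n := by linarith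
    have hpn := hp n hn
    have hlpn : l n * p n ≤ (μ - lam ^ 2) / 2 := by
      refine le_trans ?_ hlp
      rw [pow_one, mul_div_assoc', mul_comm lam, ← mul_div_assoc']
      gcongr
    have hlp0 : 0 ≤ l n * p n := mul_nonneg (Nat.cast_nonneg _) (hp0 n)
    have hp1 : p n ≤ 1 := by
      have h1 : 1 * p n ≤ l n * p n :=
        mul_le_mul_of_nonneg_right (by linarith) (hp0 n)
      linarith [sq_nonneg lam]
    have hnp : n * p n ^ 2 ≤ lam ^ 2 := by
      calc n * p n ^ 2 ≤ n * (lam / Real.sqrt n) ^ 2 :=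
            mul_le_mul_of_nonneg_left (pow_le_pow_left₀ (hp0 n) hpn 2) hn0.le
        _ = lam ^ 2 := by rw [div_pow, hsq]; field_simp
    have hδn : (l n : ℝ) ^ (4 * b) * p n ≤ δ n := by
      calc (l n : ℝ) ^ (4 * b) * p n ≤ (l n : ℝ) ^ (4 * b) * (lam / Real.sqrt n) := by gcongr
        _ = δ n := by rw [hδ]; ring
    have hmain := prob_large_component_le (n := n) (p := p n) (q := q) (μ := μ) (κ := κ) (η := η)
      (δ := δ n) (l := l n) 4 (hp0 n) hp1 hκ.le hκ1 hη.le hη1 (by exact_mod_cast hl2)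
      ((div_le_iff₀' hη).1 hlη)
      (by
        have := (div_le_iff₀' hκ).1 hlκ
        nlinarith)
      hdrift hμ1 (by linarith [sq_nonneg lam]) hq0.le
      (by nlinarith) (hb ▸ hδn) hδ1
    rw [← hb] at hmain
    refine ⟨hp1, ?_⟩
    have hql : q ^ l n ≤ 1 / (n : ℝ) ^ 3 := pow_ceil_mul_log_le hq0 hq1.le hn hKq
    have hel : Real.exp (-(l n : ℝ)) ≤ 1 / (n : ℝ) ^ 3 := by
      have h1 : Real.exp (-1) ^ l n ≤ 1 / (n : ℝ) ^ 3 :=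
        pow_ceil_mul_log_le (Real.exp_pos _) (Real.exp_le_one_iff.2 (by norm_num)) hn
          (by rw [Real.log_exp]; linarith)
      rwa [← Real.exp_nat_mul, mul_neg_one] at h1
    have htotal : (n ^ 2 + n : ℝ) * q ^ l n
        + n ^ 2 * ((4 + 1 : ℕ) * Real.exp (-(l n : ℝ)) + δ n ^ (4 + 1)) ≤ err n :=
      failure_bound_le hn hq0.le hql hel
    have hnot := one_le_prob_add_prob_not (p := p n) (fun ω : Sym2 (Fin n) → Bool =>
      ∀ e : Sym2 (Fin n), ¬ e.IsDiag → (suppOf (boxComponent (graphOf ω) e)).ncard ≤ l n ^ b)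
    refine le_trans (by linarith) (prob_mono (hp0 n) hp1 fun ω hω e he => ?_)
    calc ((suppOf (boxComponent (graphOf ω) e)).ncard : ℝ) ≤ (l n : ℝ) ^ b := by
          exact_mod_cast hω e he
      _ ≤ ((K + 1) * Real.log n) ^ b :=
          pow_le_pow_left₀ (Nat.cast_nonneg _) (ceil_mul_log_le hK0 hlogn) b
      _ = (K + 1) ^ b * Real.log n ^ b := mul_pow _ _ _
      _ ≤ _ := mul_le_mul_of_nonneg_left (pow_le_pow_right₀ hlogn hb31) (by positivity)
  have hreal : Tendsto (fun n : ℕ => prob (p n) (fun ω =>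
      ∀ e : Sym2 (Fin n), ¬ e.IsDiag → ((suppOf (boxComponent (graphOf ω) e)).ncard : ℝ)
        ≤ (K + 1) ^ b * Real.log n ^ (2 ^ 31 : ℕ))) atTop (nhds 1) := by
    refine tendsto_of_tendsto_of_tendsto_of_le_of_le' (g := fun n => 1 - err n)
      (by simpa using herr0.const_sub 1) tendsto_const_nhds (hbounds.mono fun n h => h.2)
      (hbounds.mono fun n h => prob_le_one (hp0 n) h.1 _)
  have h := ENNReal.tendsto_ofReal hreal
  rw [ENNReal.ofReal_one] at h
  exact h.congr' (hbounds.mono fun n hn => (erMeasure_eq_prob (hp0 n) hn.1 _).symm)
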